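/- arXiv:1906.10962 — 13 statements merged into one kernel-verified Lean document; each statement's English description precedes it below -/
import Mathlib

section
/- For every natural number n ≥ 1, the number of finite sets S of positive integers with max S = n and min S > |S| (strong-Schreier sets with largest element n) equals F_{n-1}, the (n-1)-st Fibonacci number. -/
theorem Finset.max_eq_coe_iff {α : Type*} [LinearOrder α] {s : Finset α} {a : α} :
    s.max = (a : WithBot α) ↔ a ∈ s ∧ ∀ x ∈ s, x ≤ a :=
  ⟨fun h => ⟨Finset.mem_of_max h, fun _ hx => Finset.le_max_of_eq hx h⟩,
    fun ⟨ha, h⟩ => le_antisymm (Finset.max_le fun x hx => WithBot.coe_le_coe.2 (h x hx))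
      (Finset.le_max ha)⟩

theorem Finset.coe_lt_min_iff {α : Type*} [LinearOrder α] {s : Finset α} {a : α} :
    (a : WithTop α) < s.min ↔ ∀ x ∈ s, a < x := by
  rw [Finset.min, Finset.lt_inf_iff (WithTop.coe_lt_top a)]
  simp

/-- The sets of the form `S \ {m + 2}`, where `S` is a strong-Schreier set with largest
element `m + 2`. -/
def strongSchreierTails (m : ℕ) : Finset (Finset ℕ) :=
  (Finset.HasAntidiagonal.antidiagonal m).biUnion fun p => (Finset.Ico (p.2 + 2) (m + 2)).powersetCard p.2

theorem mem_strongSchreierTails {m : ℕ} {T : Finset ℕ} :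
    T ∈ strongSchreierTails m ↔ ∀ x ∈ T, T.card + 2 ≤ x ∧ x < m + 2 := by
  simp only [strongSchreierTails, Finset.mem_biUnion, Finset.HasAntidiagonal.mem_antidiagonal,
    Finset.mem_powersetCard, Finset.subset_iff, Finset.mem_Ico]
  constructor
  · rintro ⟨p, -, h, hc⟩
    rwa [hc]
  · intro h
    have hle : T.card ≤ m := by
      rcases T.eq_empty_or_nonempty with rfl | ⟨x, hx⟩
      · simp
      · have := h x hx
        omega
    exact ⟨(m - T.card, T.card), Nat.sub_add_cancel hle, h, rfl⟩

theorem card_strongSchreierTails (m : ℕ) :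
    (strongSchreierTails m).card = Nat.fib (m + 1) := by
  rw [strongSchreierTails, Finset.card_biUnion, Nat.fib_succ_eq_sum_choose]
  · refine Finset.sum_congr rfl fun p hp => ?_
    rw [Finset.HasAntidiagonal.mem_antidiagonal] at hp
    rw [Finset.card_powersetCard, Nat.card_Ico]
    congr 1
    omega
  · intro p hp q hq hpq
    rw [Function.onFun, Finset.disjoint_left]
    intro T hT hT'
    rw [Finset.mem_powersetCard] at hT hT'
    rw [Finset.mem_coe, Finset.HasAntidiagonal.mem_antidiagonal] at hp hq
    refine hpq (Prod.ext ?_ ?_) <;> omega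

/-- For every `n ≥ 1`, the number of finite sets `S` of positive integers with
`max S = n` and `min S > |S|` (strong-Schreier sets with largest element `n`)
equals the `(n-1)`-st Fibonacci number. -/
theorem schreier_strong_max_card (n : ℕ) (hn : 1 ≤ n) :
    {S : Finset ℕ | (∀ x ∈ S, 0 < x) ∧ S.max = (n : WithBot ℕ) ∧
      (S.card : WithTop ℕ) < S.min}.ncard = Nat.fib (n - 1) := by
  have key (S : Finset ℕ) : ((∀ x ∈ S, 0 < x) ∧ S.max = (n : WithBot ℕ) ∧
      (S.card : WithTop ℕ) < S.min) ↔ n ∈ S ∧ (∀ x ∈ S, x ≤ n) ∧ ∀ x ∈ S, S.card < x := by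
    have h₁ : S.max = (n : WithBot ℕ) ↔ _ := Finset.max_eq_coe_iff
    have h₂ : (S.card : WithTop ℕ) < S.min ↔ _ := Finset.coe_lt_min_iff
    rw [h₁, h₂]
    exact ⟨fun ⟨_, ⟨h, h'⟩, h''⟩ => ⟨h, h', h''⟩,
      fun ⟨h, h', h''⟩ => ⟨fun x hx => (Nat.zero_le _).trans_lt (h'' x hx), ⟨h, h'⟩, h''⟩⟩
  simp only [key]
  obtain rfl | ⟨m, rfl⟩ : n = 1 ∨ ∃ m, n = m + 2 := by
    rcases hn.eq_or_lt with h | h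
    · exact Or.inl h.symm
    · exact Or.inr ⟨n - 2, by omega⟩
  · have : {S : Finset ℕ | 1 ∈ S ∧ (∀ x ∈ S, x ≤ 1) ∧ ∀ x ∈ S, S.card < x} = ∅ :=
      Set.eq_empty_of_forall_notMem fun S ⟨h, _, hlt⟩ =>
        (Finset.card_pos.2 ⟨1, h⟩).not_ge (Nat.lt_one_iff.1 (hlt 1 h)).le
    rw [this, Set.ncard_empty]
    rfl
  · have notMem {T : Finset ℕ} (hT : T ∈ strongSchreierTails m) : m + 2 ∉ T := fun h =>
      (mem_strongSchreierTails.1 hT _ h).2.false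
    have hS : {S : Finset ℕ | m + 2 ∈ S ∧ (∀ x ∈ S, x ≤ m + 2) ∧ ∀ x ∈ S, S.card < x} =
        insert (m + 2) '' (strongSchreierTails m : Set (Finset ℕ)) := by
      ext S
      simp only [Set.mem_ofPred_eq, Set.mem_image, Finset.mem_coe]
      constructor
      · rintro ⟨h, hle, hlt⟩
        refine ⟨S.erase (m + 2), mem_strongSchreierTails.2 fun x hx => ?_,
          Finset.insert_erase h⟩
        have hc := Finset.card_erase_add_one h
        obtain ⟨hne, hx⟩ := Finset.mem_erase.1 hx
        have := hle x hx
        have := hlt x hx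
        omega
      · rintro ⟨T, hT, rfl⟩
        rw [Finset.card_insert_of_notMem (notMem hT)]
        have h := mem_strongSchreierTails.1 hT
        have hc : T.card + 1 < m + 2 := by
          rcases T.eq_empty_or_nonempty with rfl | ⟨x, hx⟩
          · simp
          · have := h x hx
            omega
        simp only [Finset.mem_insert, forall_eq_or_imp, true_or, le_refl, true_and]
        exact ⟨fun x hx => (h x hx).2.le, hc, fun x hx => (h x hx).1⟩
    rw [hS, Set.InjOn.ncard_image, Set.ncard_coe_finset, card_strongSchreierTails]
    · rfl
    · intro T hT T' hT' h
      rw [← Finset.erase_insert (notMem hT), h, Finset.erase_insert (notMem hT')]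
end

section
/- For every natural number n ≥ 2, the number of finite sets S of positive integers with max S = n and min S = |S| (maximal Schreier sets with largest element n) equals F_{n-2}, the (n-2)-nd Fibonacci number; moreover for n = 1 this count equals 1. -/
theorem Finset.min_eq_coe_iff {α : Type*} [LinearOrder α] {s : Finset α} {a : α} :
    s.min = (a : WithTop α) ↔ a ∈ s ∧ ∀ x ∈ s, a ≤ x :=
  ⟨fun h => ⟨Finset.mem_of_min h, fun _ hx => Finset.min_le_of_eq hx h⟩,
    fun h => le_antisymm (Finset.min_le h.1)
      (Finset.le_min fun x hx => WithTop.coe_le_coe.2 (h.2 x hx))⟩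

theorem maximalSchreier_iff {n : ℕ} {S : Finset ℕ} :
    ((∀ x ∈ S, 0 < x) ∧ S.max = (n : WithBot ℕ) ∧ S.min = (S.card : WithTop ℕ)) ↔
      n ∈ S ∧ S.card ∈ S ∧ ∀ x ∈ S, S.card ≤ x ∧ x ≤ n := by
  have hmax : S.max = (n : WithBot ℕ) ↔ n ∈ S ∧ ∀ x ∈ S, x ≤ n := Finset.max_eq_coe_iff
  have hmin : S.min = (S.card : WithTop ℕ) ↔ S.card ∈ S ∧ ∀ x ∈ S, S.card ≤ x :=
    Finset.min_eq_coe_iff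
  rw [hmax, hmin]
  refine ⟨fun ⟨_, ⟨h₁, h₂⟩, h₃, h₄⟩ => ⟨h₁, h₃, fun x hx => ⟨h₄ x hx, h₂ x hx⟩⟩,
    fun ⟨h₁, h₂, h₃⟩ => ⟨fun x hx => ?_, ⟨h₁, fun x hx => (h₃ x hx).2⟩, h₂,
      fun x hx => (h₃ x hx).1⟩⟩
  exact (Finset.card_pos.2 ⟨x, hx⟩).trans_le (h₃ x hx).1

theorem card_le_one_of_forall_mem_le_and_ge {S : Finset ℕ} {n : ℕ}
    (h : ∀ x ∈ S, n ≤ x ∧ x ≤ n) :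
    S.card ≤ 1 :=
  Finset.card_le_one.2 fun a ha b hb => by have := h a ha; have := h b hb; omega

/-- A maximal Schreier set with largest element `m + 3` and cardinality `k + 2` consists of
`k + 2`, `m + 3` and `k` elements strictly in between. -/
theorem ncard_maximalSchreier_add_three (m : ℕ) :
    {S : Finset ℕ | m + 3 ∈ S ∧ S.card ∈ S ∧ ∀ x ∈ S, S.card ≤ x ∧ x ≤ m + 3}.ncard =
      Nat.fib (m + 1) := by
  let F : Finset (Σ _ : ℕ × ℕ, Finset ℕ) := (Finset.HasAntidiagonal.antidiagonal m).sigma fun p =>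
    Finset.powersetCard p.2 (Finset.Ioo (p.2 + 2) (m + 3))
  have hF : F.card = Nat.fib (m + 1) := by
    rw [Finset.card_sigma, Nat.fib_succ_eq_sum_choose]
    refine Finset.sum_congr rfl fun p hp => ?_
    rw [Finset.HasAntidiagonal.mem_antidiagonal] at hp
    rw [Finset.card_powersetCard, Nat.card_Ioo]
    congr 1
    omega
  have hmem (i j : ℕ) (T : Finset ℕ) : (⟨(i, j), T⟩ : Σ _ : ℕ × ℕ, Finset ℕ) ∈ F ↔
      i + j = m ∧ (∀ x ∈ T, j + 2 < x ∧ x < m + 3) ∧ T.card = j := by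
    simp [F, Finset.mem_powersetCard, Finset.subset_iff]
  have hcard {i j : ℕ} {T : Finset ℕ} (h : (⟨(i, j), T⟩ : Σ _ : ℕ × ℕ, Finset ℕ) ∈ F) :
      (insert (j + 2) (insert (m + 3) T)).card = j + 2 := by
    obtain ⟨h₁, h₂, h₃⟩ := (hmem i j T).1 h
    rw [Finset.card_insert_of_notMem, Finset.card_insert_of_notMem, h₃]
    · exact fun h => by have := h₂ _ h; omega
    · rw [Finset.mem_insert, not_or]
      exact ⟨by omega, fun h => by have := h₂ _ h; omega⟩
  rw [← hF, ← Set.ncard_coe_finset]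
  symm
  refine Set.ncard_congr (fun q _ => insert (q.1.2 + 2) (insert (m + 3) q.2)) ?_ ?_ ?_
  · rintro ⟨⟨i, j⟩, T⟩ h
    rw [Finset.mem_coe] at h
    obtain ⟨h₁, h₂, h₃⟩ := (hmem i j T).1 h
    simp only [Set.mem_ofPred_eq, hcard h]
    refine ⟨by simp, by simp, fun x hx => ?_⟩
    simp only [Finset.mem_insert] at hx
    rcases hx with rfl | rfl | hx
    · omega
    · omega
    · have := h₂ x hx
      omega
  · rintro ⟨⟨i, j⟩, T⟩ ⟨⟨i', j'⟩, T'⟩ h h' heq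
    rw [Finset.mem_coe] at h h'
    dsimp only at heq
    have hj : j = j' := by
      have := congrArg Finset.card heq
      rw [hcard h, hcard h'] at this
      omega
    subst hj
    obtain ⟨h₁, h₂, h₃⟩ := (hmem i j T).1 h
    obtain ⟨h₁', h₂', h₃'⟩ := (hmem i' j T').1 h'
    obtain rfl : i = i' := by omega
    have hT : T = T' := by
      ext x
      have hx := Finset.ext_iff.1 heq x
      simp only [Finset.mem_insert] at hx
      have := h₂ x
      have := h₂' x
      grind
    rw [hT]
  · rintro S ⟨h₁, h₂, h₃⟩
    have hlt : S.card < m + 3 := by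
      refine lt_of_le_of_ne (h₃ _ h₁).1 fun h => ?_
      rw [h] at h₃
      have := card_le_one_of_forall_mem_le_and_ge h₃
      omega
    have hmem' : m + 3 ∈ S.erase S.card := Finset.mem_erase.2 ⟨hlt.ne', h₁⟩
    have hcard' := Finset.card_erase_add_one h₂
    have hcard'' := Finset.card_erase_add_one hmem'
    refine ⟨⟨(m + 2 - S.card, S.card - 2), (S.erase S.card).erase (m + 3)⟩, ?_, ?_⟩
    · rw [Finset.mem_coe, hmem]
      refine ⟨by omega, fun x hx => ?_, by omega⟩
      simp only [Finset.mem_erase] at hx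
      have := h₃ x hx.2.2
      omega
    · dsimp only
      rw [Finset.insert_erase hmem', show S.card - 2 + 2 = S.card by omega,
        Finset.insert_erase h₂]

/-- For every `n ≥ 2`, the number of finite sets `S` of positive integers with
`max S = n` and `min S = |S|` (maximal Schreier sets with largest element `n`)
equals the `(n-2)`-nd Fibonacci number; moreover for `n = 1` this count equals `1`. -/
theorem schreier_maximal_max_card :
    (∀ n : ℕ, 2 ≤ n →
      {S : Finset ℕ | (∀ x ∈ S, 0 < x) ∧ S.max = (n : WithBot ℕ) ∧
        S.min = (S.card : WithTop ℕ)}.ncard = Nat.fib (n - 2)) ∧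
    {S : Finset ℕ | (∀ x ∈ S, 0 < x) ∧ S.max = ((1 : ℕ) : WithBot ℕ) ∧
      S.min = (S.card : WithTop ℕ)}.ncard = 1 := by
  simp only [maximalSchreier_iff]
  refine ⟨fun n hn => ?_, ?_⟩
  · obtain rfl | hn := hn.eq_or_lt
    · rw [Nat.sub_self, Nat.fib_zero]
      convert Set.ncard_empty (Finset ℕ)
      refine Set.eq_empty_of_forall_notMem ?_
      rintro S ⟨h₁, h₂, h₃⟩
      have hle := (h₃ 2 h₁).1
      have hpos := Finset.card_pos.2 ⟨2, h₁⟩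
      obtain h | h : S.card = 1 ∨ S.card = 2 := by omega
      · have := Finset.card_le_one.1 h.le _ h₁ _ h₂
        omega
      · rw [h] at h₃
        have := card_le_one_of_forall_mem_le_and_ge h₃
        omega
    · obtain ⟨m, rfl⟩ := Nat.exists_eq_add_of_le' hn
      exact ncard_maximalSchreier_add_three m
  · rw [Set.ncard_eq_one]
    refine ⟨{1}, Set.eq_singleton_iff_unique_mem.2 ⟨by simp, ?_⟩⟩
    rintro S ⟨h₁, -, h₃⟩
    have hpos := Finset.card_pos.2 ⟨1, h₁⟩
    refine Finset.eq_singleton_iff_unique_mem.2 ⟨h₁, fun x hx => ?_⟩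
    have := h₃ x hx
    omega
end

section
/- For every natural number n ≥ 1, the number of subsets S of {1, 2, ..., n} that are either empty or satisfy min S ≥ |S| (weak-Schreier subsets, including the empty set) equals F_{n+2}, the (n+2)-nd Fibonacci number. -/
/-- A finite set `S` is empty or satisfies `|S| ≤ min S` iff every element is at least `|S|`. -/
lemma eq_empty_or_card_le_min_iff (S : Finset ℕ) :
    (S = ∅ ∨ (S.card : WithTop ℕ) ≤ S.min) ↔ ∀ x ∈ S, S.card ≤ x := by
  have key : ((S.card : WithTop ℕ) ≤ S.min) ↔ ∀ x ∈ S, S.card ≤ x := by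
    rw [Finset.le_min_iff]
    exact forall₂_congr fun x _ => WithTop.coe_le_coe
  rw [key, or_iff_right_iff_imp]
  rintro rfl
  simp

/-- The sets `S ⊆ {1, …, n}` of cardinality `k` whose elements are all at least `k`
are the `k`-element subsets of `{k, …, n}`. -/
lemma filter_weak_schreier_card_eq (n k : ℕ) :
    ((Finset.Icc 1 n).powerset.filter
      (fun S => S = ∅ ∨ (S.card : WithTop ℕ) ≤ S.min)).filter (fun S => S.card = k) =
      (Finset.Icc k n).powersetCard k := by
  ext S
  simp only [Finset.mem_filter, Finset.mem_powerset, Finset.mem_powersetCard,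
    eq_empty_or_card_le_min_iff, Finset.subset_iff, Finset.mem_Icc]
  constructor
  · rintro ⟨⟨h₁, h₂⟩, rfl⟩
    exact ⟨fun x hx => ⟨h₂ x hx, (h₁ hx).2⟩, rfl⟩
  · rintro ⟨h, rfl⟩
    refine ⟨⟨fun x hx => ⟨?_, (h hx).2⟩, fun x hx => (h hx).1⟩, rfl⟩
    exact (Finset.card_pos.2 ⟨x, hx⟩).trans_le (h hx).1

/-- For every `n ≥ 1`, the number of subsets `S` of `{1, …, n}` that are either
empty or satisfy `min S ≥ |S|` (weak-Schreier subsets, including the empty set)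
equals the `(n+2)`-nd Fibonacci number. -/
theorem card_weak_schreier_subsets (n : ℕ) (hn : 1 ≤ n) :
    ((Finset.Icc 1 n).powerset.filter
      (fun S => S = ∅ ∨ (S.card : WithTop ℕ) ≤ S.min)).card = Nat.fib (n + 2) := by
  have hmaps : ∀ S ∈ (Finset.Icc 1 n).powerset.filter
      (fun S => S = ∅ ∨ (S.card : WithTop ℕ) ≤ S.min),
      (n + 1 - S.card, S.card) ∈ Finset.HasAntidiagonal.antidiagonal (n + 1) := by
    intro S hS
    have h := Finset.card_le_card (Finset.mem_powerset.1 (Finset.mem_filter.1 hS).1)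
    rw [Nat.card_Icc] at h
    rw [Finset.HasAntidiagonal.mem_antidiagonal]
    dsimp only
    omega
  rw [Nat.fib_succ_eq_sum_choose (n + 1), Finset.card_eq_sum_card_fiberwise hmaps]
  refine Finset.sum_congr rfl fun p hp => ?_
  rw [Finset.HasAntidiagonal.mem_antidiagonal] at hp
  have hfiber : ∀ S : Finset ℕ, (n + 1 - S.card, S.card) = p ↔ S.card = p.2 := by
    intro S
    rw [Prod.ext_iff]
    dsimp only
    omega
  simp only [hfiber]
  rw [filter_weak_schreier_card_eq, Finset.card_powersetCard, Nat.card_Icc,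
    ← hp, Nat.add_sub_cancel]
end

section
/- For every natural number n ≥ 1, the number of subsets S of {1, 2, ..., n} that are either empty or satisfy min S > |S| (strong-Schreier subsets, including the empty set) equals F_{n+1}, the (n+1)-st Fibonacci number. -/
theorem Finset.eq_empty_or_card_lt_min_iff (S : Finset ℕ) :
    (S = ∅ ∨ (S.card : WithTop ℕ) < S.min) ↔ ∀ x ∈ S, S.card < x := by
  rcases S.eq_empty_or_nonempty with rfl | hS
  · simp
  · rw [← Finset.coe_min' hS]
    simp only [hS.ne_empty, false_or]
    rw [← Finset.lt_min'_iff S hS]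
    exact WithTop.coe_lt_coe

/-- For every `n ≥ 1`, the number of subsets `S` of `{1, …, n}` that are either
empty or satisfy `min S > |S|` (strong-Schreier subsets, including the empty set)
equals the `(n+1)`-st Fibonacci number. -/
theorem card_strong_schreier_subsets (n : ℕ) (hn : 1 ≤ n) :
    ((Finset.Icc 1 n).powerset.filter
      (fun S => S = ∅ ∨ (S.card : WithTop ℕ) < S.min)).card = Nat.fib (n + 1) := by
  simp only [Finset.eq_empty_or_card_lt_min_iff]
  rw [Nat.fib_succ_eq_sum_choose, ← Finset.Nat.sum_antidiagonal_swap,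
    Finset.Nat.sum_antidiagonal_eq_sum_range_succ_mk,
    Finset.card_eq_sum_card_fiberwise (f := Finset.card) (t := Finset.range n.succ)]
  · refine Finset.sum_congr rfl fun k _ => ?_
    have h : (((Finset.Icc 1 n).powerset.filter fun S => ∀ x ∈ S, S.card < x).filter
        fun S => S.card = k) = (Finset.Icc (k + 1) n).powersetCard k := by
      ext S
      simp only [Finset.mem_filter, Finset.mem_powerset, Finset.mem_powersetCard,
        Finset.subset_iff, Finset.mem_Icc]
      grind
    rw [h, Finset.card_powersetCard, Nat.card_Icc, Nat.add_sub_add_right]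
    rfl
  · intro S hS
    have h := Finset.card_le_card (Finset.mem_powerset.mp (Finset.mem_filter.mp hS).1)
    rw [Nat.card_Icc] at h
    simpa using h
end

section
/- For every natural number n ≥ 1, the number of subsets S of {1, 2, ..., n} that are either empty or satisfy both min S ≥ |S| and max S even equals F_n if n is odd, and equals F_{n+1} if n is even. -/
open Finset in
/-- The subsets of `{1, …, n}` whose elements all exceed their cardinality are counted by the
Fibonacci numbers. -/
theorem card_filter_card_lt_eq_fib (n : ℕ) :
    ((Icc 1 n).powerset.filter (fun S => ∀ x ∈ S, S.card < x)).card = Nat.fib (n + 1) := by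
  rw [Nat.fib_succ_eq_sum_choose, card_eq_sum_card_fiberwise (t := antidiagonal n)
    (f := fun S => (n - S.card, S.card))]
  · refine sum_congr rfl fun p hp => ?_
    obtain ⟨i, k⟩ := p
    rw [HasAntidiagonal.mem_antidiagonal] at hp
    simp only at hp
    have hcard : (powersetCard k (Icc (k + 1) n)).card = i.choose k := by
      rw [card_powersetCard, Nat.card_Icc]
      congr 1
      omega
    rw [← hcard]
    congr 1
    ext S
    simp only [mem_filter, mem_powerset, mem_powersetCard, Prod.mk.injEq, subset_iff, mem_Icc]
    constructor
    · rintro ⟨⟨h₁, h₂⟩, -, rfl⟩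
      exact ⟨fun x hx => ⟨h₂ x hx, (h₁ hx).2⟩, rfl⟩
    · rintro ⟨h₁, rfl⟩
      refine ⟨⟨fun x hx => ⟨?_, (h₁ hx).2⟩, fun x hx => (h₁ hx).1⟩, by omega, rfl⟩
      have := (h₁ hx).1
      omega
  · intro S hS
    simp only [coe_filter, mem_powerset, Set.mem_ofPred_eq] at hS
    have := card_le_card hS.1
    rw [Nat.card_Icc] at this
    simp only [SetLike.mem_coe, HasAntidiagonal.mem_antidiagonal]
    omega

/-- The order-theoretic form of the condition that `S` is empty, or weak-Schreier with even
maximum. -/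
theorem weak_schreier_even_max_iff (S : Finset ℕ) :
    (S = ∅ ∨ ((S.card : WithTop ℕ) ≤ S.min ∧ ∃ m : ℕ, S.max = (m : WithBot ℕ) ∧ Even m)) ↔
      S = ∅ ∨ ((∀ x ∈ S, S.card ≤ x) ∧ ∃ m ∈ S, (∀ x ∈ S, x ≤ m) ∧ Even m) := by
  refine or_congr_right (and_congr ?_ (exists_congr fun m => ?_))
  · rw [Finset.le_min_iff]
    exact forall₂_congr fun x _ => WithTop.coe_le_coe
  · rw [← and_assoc]
    refine and_congr_left fun _ => ⟨fun h => ?_, fun ⟨hm, h⟩ => ?_⟩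
    · exact ⟨Finset.mem_of_max h, fun x hx => Finset.le_max_of_eq hx h⟩
    · refine le_antisymm ?_ (Finset.le_max hm)
      exact Finset.max_le fun x hx => WithBot.coe_le_coe.2 (h x hx)

open Classical Finset in
/-- Passing from `{1, …, n}` to `{1, …, n + 1}` adds no sets with even maximum if `n + 1` is odd,
and adds `F (n + 1)` weak-Schreier sets if `n + 1` is even. -/
theorem card_weak_schreier_even_max_succ (n : ℕ) :
    ((Icc 1 (n + 1)).powerset.filter
      (fun S => S = ∅ ∨ ((S.card : WithTop ℕ) ≤ S.min ∧
        ∃ m : ℕ, S.max = (m : WithBot ℕ) ∧ Even m))).card =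
    ((Icc 1 n).powerset.filter
      (fun S => S = ∅ ∨ ((S.card : WithTop ℕ) ≤ S.min ∧
        ∃ m : ℕ, S.max = (m : WithBot ℕ) ∧ Even m))).card +
      if Even (n + 1) then Nat.fib (n + 1) else 0 := by
  simp only [weak_schreier_even_max_iff]
  have hnot : ∀ S ∈ (Icc 1 n).powerset, n + 1 ∉ S := fun S hS h => by
    have := mem_Icc.1 (mem_powerset.1 hS h)
    omega
  rw [← insert_Icc_right_eq_Icc_add_one (by omega : 1 ≤ n + 1), powerset_insert, filter_union,
    card_union_of_disjoint, filter_image, card_image_of_injOn]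
  · congr 1
    have key : ∀ S ∈ (Icc 1 n).powerset,
        ((insert (n + 1) S = ∅ ∨ ((∀ x ∈ insert (n + 1) S, (insert (n + 1) S).card ≤ x) ∧
          ∃ m ∈ insert (n + 1) S, (∀ x ∈ insert (n + 1) S, x ≤ m) ∧ Even m)) ↔
        ((∀ x ∈ S, S.card < x) ∧ Even (n + 1))) := by
      intro S hS
      have hle : ∀ x ∈ S, x ≤ n := fun x hx => (mem_Icc.1 (mem_powerset.1 hS hx)).2
      have hcard : S.card ≤ n := by simpa using card_le_card (mem_powerset.1 hS)
      simp only [card_insert_of_notMem (hnot S hS), insert_ne_empty, false_or, forall_mem_insert]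
      constructor
      · rintro ⟨⟨-, h⟩, m, hm, ⟨hnm, -⟩, he⟩
        refine ⟨h, ?_⟩
        rcases mem_insert.1 hm with rfl | hm
        · exact he
        · have := hle m hm
          omega
      · rintro ⟨h, he⟩
        exact ⟨⟨by omega, h⟩, n + 1, mem_insert_self _ _,
          ⟨le_rfl, fun x hx => (hle x hx).trans n.le_succ⟩, he⟩
    rw [filter_congr key]
    split_ifs with he
    · simp only [he, and_true]
      convert card_filter_card_lt_eq_fib n
    · simp [he]
  · intro S hS T hT h
    have hS' := hnot S (mem_filter.1 hS).1
    have hT' := hnot T (mem_filter.1 hT).1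
    rw [← erase_insert hS', ← erase_insert hT']
    exact congrArg (fun U => U.erase (n + 1)) h
  · rw [disjoint_left]
    intro S hS hS'
    obtain ⟨T, -, rfl⟩ := mem_image.1 (mem_filter.1 hS').1
    exact hnot _ (mem_filter.1 hS).1 (mem_insert_self _ _)

open Classical in
/-- For every `n ≥ 1`, the number of subsets `S` of `{1, …, n}` that are either
empty or satisfy both `min S ≥ |S|` and `max S` even equals `F n` if `n` is odd,
and equals `F (n+1)` if `n` is even. -/
theorem card_weak_schreier_even_max (n : ℕ) (hn : 1 ≤ n) :
    (Odd n →
      ((Finset.Icc 1 n).powerset.filter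
        (fun S => S = ∅ ∨ ((S.card : WithTop ℕ) ≤ S.min ∧
          ∃ m : ℕ, S.max = (m : WithBot ℕ) ∧ Even m))).card = Nat.fib n) ∧
    (Even n →
      ((Finset.Icc 1 n).powerset.filter
        (fun S => S = ∅ ∨ ((S.card : WithTop ℕ) ≤ S.min ∧
          ∃ m : ℕ, S.max = (m : WithBot ℕ) ∧ Even m))).card = Nat.fib (n + 1)) := by
  clear hn
  induction n with
  | zero => simp [Finset.filter_singleton]
  | succ n ih =>
    rw [card_weak_schreier_even_max_succ]
    refine ⟨fun ho => ?_, fun he => ?_⟩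
    · have hn : Even n := by simpa [Nat.odd_add_one] using ho
      rw [if_neg (Nat.not_even_iff_odd.2 ho), ih.2 hn, add_zero]
    · have hn : Odd n := by simpa [Nat.even_add_one] using he
      rw [if_pos he, ih.1 hn, ← Nat.fib_add_two]
end

section
/- For every natural number n ≥ 1, the number of subsets S of {1, 2, ..., n} that are either empty or satisfy both min S > |S| and max S odd equals F_n if n is odd, and equals F_{n-1} if n is even. -/
/-- `S` is empty, or it is strong-Schreier with odd maximum. -/
def StrongSchreierOddMax (S : Finset ℕ) : Prop :=
  S = ∅ ∨ ((S.card : WithTop ℕ) < S.min ∧ ∃ m : ℕ, S.max = (m : WithBot ℕ) ∧ Odd m)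

theorem Finset.coe_card_lt_min_iff (S : Finset ℕ) :
    (S.card : WithTop ℕ) < S.min ↔ ∀ x ∈ S, S.card < x := by
  constructor
  · intro h x hx
    exact WithTop.coe_lt_coe.1 (h.trans_le (Finset.min_le hx))
  · intro h
    rcases S.eq_empty_or_nonempty with rfl | hS
    · exact WithTop.coe_lt_top 0
    · obtain ⟨a, ha⟩ := Finset.min_of_nonempty hS
      rw [ha]
      exact WithTop.coe_lt_coe.2 (h a (Finset.mem_of_min ha))

theorem strongSchreierOddMax_insert_iff {n : ℕ} {T : Finset ℕ} (hT : T ⊆ Finset.Icc 1 n) :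
    StrongSchreierOddMax (insert (n + 1) T) ↔
      Odd (n + 1) ∧ T.card < n ∧ ∀ x ∈ T, T.card + 1 < x := by
  have hnotMem : n + 1 ∉ T := fun h => by simpa using hT h
  have hmax : (insert (n + 1) T).max = ((n + 1 : ℕ) : WithBot ℕ) := by
    apply le_antisymm
    · refine Finset.max_le fun x hx => ?_
      rcases Finset.mem_insert.1 hx with rfl | hx
      · exact le_rfl
      · have := Finset.mem_Icc.1 (hT hx)
        exact WithBot.coe_le_coe.2 (this.2.trans n.le_succ)
    · exact Finset.le_max (Finset.mem_insert_self _ _)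
  have hodd : (∃ m : ℕ, ((n + 1 : ℕ) : WithBot ℕ) = (m : WithBot ℕ) ∧ Odd m) ↔ Odd (n + 1) := by
    constructor
    · rintro ⟨m, hm, h⟩
      exact (WithBot.coe_injective hm : n + 1 = m) ▸ h
    · exact fun h => ⟨_, rfl, h⟩
  rw [StrongSchreierOddMax, Finset.coe_card_lt_min_iff, hmax, hodd,
    Finset.card_insert_of_notMem hnotMem, Finset.forall_mem_insert, Nat.succ_lt_succ_iff]
  simp only [Finset.insert_ne_empty, false_or]
  tauto

open Classical in
theorem card_filter_card_add_one_lt (n : ℕ) :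
    ((Finset.Icc 1 n).powerset.filter
      (fun T => T.card < n ∧ ∀ x ∈ T, T.card + 1 < x)).card = Nat.fib n := by
  have hunion : (Finset.Icc 1 n).powerset.filter
      (fun T => T.card < n ∧ ∀ x ∈ T, T.card + 1 < x) =
      (Finset.range n).biUnion fun t => Finset.powersetCard t (Finset.Icc (t + 2) n) := by
    ext T
    simp only [Finset.mem_filter, Finset.mem_powerset, Finset.mem_biUnion, Finset.mem_range,
      Finset.mem_powersetCard, Finset.subset_iff, Finset.mem_Icc]
    constructor
    · rintro ⟨hT, hcard, hlt⟩
      exact ⟨T.card, hcard, fun x hx => ⟨hlt x hx, (hT hx).2⟩, rfl⟩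
    · rintro ⟨t, ht, hT, rfl⟩
      exact ⟨fun x hx => ⟨by have := (hT hx).1; omega, (hT hx).2⟩, ht, fun x hx => (hT hx).1⟩
  rw [hunion, Finset.card_biUnion fun s _ t _ hst => Finset.disjoint_left.2 fun T hs ht =>
    hst ((Finset.mem_powersetCard.1 hs).2.symm.trans (Finset.mem_powersetCard.1 ht).2)]
  cases n with
  | zero => simp
  | succ k =>
    rw [Nat.fib_succ_eq_sum_choose,
      ← Finset.Nat.sum_antidiagonal_swap, Finset.Nat.sum_antidiagonal_eq_sum_range_succ_mk]
    refine Finset.sum_congr rfl fun t ht => ?_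
    rw [Finset.card_powersetCard, Nat.card_Icc]
    have := Finset.mem_range.1 ht
    congr 1
    dsimp only [Prod.swap]
    omega

open Classical in
theorem card_filter_strongSchreierOddMax_succ (n : ℕ) :
    ((Finset.Icc 1 (n + 1)).powerset.filter StrongSchreierOddMax).card =
      ((Finset.Icc 1 n).powerset.filter StrongSchreierOddMax).card +
        if Odd (n + 1) then Nat.fib n else 0 := by
  have hnotMem {T : Finset ℕ} (hT : T ∈ (Finset.Icc 1 n).powerset) : n + 1 ∉ T :=
    fun h => by simpa using Finset.mem_powerset.1 hT h
  rw [← Finset.insert_Icc_right_eq_Icc_add_one (by omega), Finset.powerset_insert,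
    Finset.filter_union, Finset.card_union_of_disjoint, Finset.filter_image,
    Finset.card_image_of_injOn]
  · congr 1
    rw [Finset.filter_congr fun T hT =>
      strongSchreierOddMax_insert_iff (Finset.mem_powerset.1 hT)]
    split_ifs with h
    · simpa only [h, true_and] using card_filter_card_add_one_lt n
    · simp [h]
  · intro S hS T hT hST
    have hS' := hnotMem (Finset.mem_filter.1 hS).1
    have hT' := hnotMem (Finset.mem_filter.1 hT).1
    rw [← Finset.erase_insert hS', ← Finset.erase_insert hT']
    exact congrArg (fun U => Finset.erase U (n + 1)) hST
  · rw [Finset.disjoint_left]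
    intro S hS hS'
    obtain ⟨T, -, rfl⟩ := Finset.mem_image.1 (Finset.mem_filter.1 hS').1
    exact hnotMem (Finset.mem_filter.1 hS).1 (Finset.mem_insert_self _ _)

open Classical in
theorem card_filter_strongSchreierOddMax_odd (k : ℕ) :
    ((Finset.Icc 1 (2 * k + 1)).powerset.filter StrongSchreierOddMax).card =
      Nat.fib (2 * k + 1) := by
  induction k with
  | zero =>
    rw [card_filter_strongSchreierOddMax_succ]
    simp [StrongSchreierOddMax, Finset.filter_singleton]
  | succ k ih =>
    rw [card_filter_strongSchreierOddMax_succ, show 2 * (k + 1) = 2 * k + 1 + 1 by ring,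
      card_filter_strongSchreierOddMax_succ, ih, if_neg (by grind), if_pos (by grind), add_zero,
      Nat.fib_add_two (n := 2 * k + 1)]

open Classical in
/-- For every `n ≥ 1`, the number of subsets `S` of `{1, …, n}` that are either
empty or satisfy both `min S > |S|` and `max S` odd equals `F n` if `n` is odd,
and equals `F (n-1)` if `n` is even. -/
theorem card_strong_schreier_odd_max (n : ℕ) (hn : 1 ≤ n) :
    (Odd n →
      ((Finset.Icc 1 n).powerset.filter
        (fun S => S = ∅ ∨ ((S.card : WithTop ℕ) < S.min ∧
          ∃ m : ℕ, S.max = (m : WithBot ℕ) ∧ Odd m))).card = Nat.fib n) ∧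
    (Even n →
      ((Finset.Icc 1 n).powerset.filter
        (fun S => S = ∅ ∨ ((S.card : WithTop ℕ) < S.min ∧
          ∃ m : ℕ, S.max = (m : WithBot ℕ) ∧ Odd m))).card = Nat.fib (n - 1)) := by
  constructor
  · rintro ⟨k, rfl⟩
    convert card_filter_strongSchreierOddMax_odd k
    rfl
  · intro h
    obtain ⟨k, rfl⟩ : ∃ k, n = 2 * k + 1 + 1 := ⟨n / 2 - 1, by grind⟩
    have hcard := card_filter_strongSchreierOddMax_succ (2 * k + 1)
    rw [card_filter_strongSchreierOddMax_odd, if_neg (Nat.not_odd_iff_even.2 h), add_zero] at hcard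
    convert hcard <;> rfl
end

section
/- For every natural number n ≥ 1, the number of subsets S of {1, 2, ..., n} that are either empty or satisfy min S ≥ |S| equals the number of subsets of {1, 2, ..., n} containing no two consecutive integers (i.e., containing no pair {m, m+1}). -/
theorem card_le_min_iff {S : Finset ℕ} :
    (S = ∅ ∨ (S.card : WithTop ℕ) ≤ S.min) ↔ ∀ x ∈ S, S.card ≤ x := by
  constructor
  · rintro (rfl | h) x hx
    · simp at hx
    · exact WithTop.coe_le_coe.mp (h.trans (Finset.min_le hx))
  · exact fun h => Or.inr (Finset.le_min fun x hx => WithTop.coe_le_coe.mpr (h x hx))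

open Classical in
theorem card_weak_schreier_eq_fib (n : ℕ) :
    ((Finset.Icc 1 n).powerset.filter
      (fun S => S = ∅ ∨ (S.card : WithTop ℕ) ≤ S.min)).card = Nat.fib (n + 2) := by
  rw [Nat.fib_succ_eq_sum_choose, ← Finset.Nat.sum_antidiagonal_swap,
    Finset.Nat.sum_antidiagonal_eq_sum_range_succ_mk,
    Finset.card_eq_sum_card_fiberwise (f := Finset.card) (t := Finset.range (n + 1).succ)]
  · refine Finset.sum_congr rfl fun k _ => ?_
    have fiber : (((Finset.Icc 1 n).powerset.filter
        (fun S => S = ∅ ∨ (S.card : WithTop ℕ) ≤ S.min)).filter (fun S => S.card = k)) =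
        (Finset.Icc k n).powersetCard k := by
      ext S
      simp only [Finset.mem_filter, Finset.mem_powerset, Finset.mem_powersetCard,
        card_le_min_iff, Finset.subset_iff, Finset.mem_Icc]
      constructor
      · rintro ⟨⟨hS, hmin⟩, rfl⟩
        exact ⟨fun x hx => ⟨hmin x hx, (hS hx).2⟩, rfl⟩
      · rintro ⟨hS, rfl⟩
        refine ⟨⟨fun x hx => ⟨?_, (hS hx).2⟩, fun x hx => (hS hx).1⟩, rfl⟩
        exact (Finset.card_pos.mpr ⟨x, hx⟩).trans_le (hS hx).1
    rw [fiber, Finset.card_powersetCard, Nat.card_Icc]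
    rfl
  · intro S hS
    have hsub := (Finset.mem_powerset.mp (Finset.mem_filter.mp hS).1)
    have := Finset.card_le_card hsub
    simp only [Nat.card_Icc] at this
    simp only [Finset.coe_range, Set.mem_Iio]
    omega

open Classical in
theorem card_zeckendorf_eq_fib (n : ℕ) :
    ((Finset.Icc 1 n).powerset.filter
      (fun S => ∀ m : ℕ, ¬(m ∈ S ∧ m + 1 ∈ S))).card = Nat.fib (n + 2) := by
  induction n using Nat.twoStepInduction with
  | zero => simp [Finset.filter_singleton]
  | one =>
    rw [Finset.filter_true_of_mem]
    · simp [Nat.fib]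
    · intro S hS m hm
      have h₁ := Finset.mem_Icc.mp (Finset.mem_powerset.mp hS hm.1)
      have h₂ := Finset.mem_Icc.mp (Finset.mem_powerset.mp hS hm.2)
      omega
  | more n ih₀ ih₁ =>
    rw [Nat.fib_add_two, ← ih₀, ← ih₁,
      ← Finset.card_filter_add_card_filter_not (fun S : Finset ℕ => n + 2 ∈ S)]
    congr 1
    · refine Finset.card_nbij' (fun S => S.erase (n + 2)) (fun S => insert (n + 2) S) ?_ ?_ ?_ ?_
      · intro S hS
        simp only [Finset.coe_filter, Finset.mem_filter, Finset.mem_powerset, Set.mem_ofPred_eq,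
          Finset.subset_iff, Finset.mem_Icc, Finset.mem_erase] at hS ⊢
        obtain ⟨⟨hsub, hS⟩, hmem⟩ := hS
        refine ⟨fun x hx => ?_, fun m hm => hS m ⟨hm.1.2, hm.2.2⟩⟩
        have hx' := hsub hx.2
        have : x ≠ n + 1 := by
          rintro rfl
          exact hS _ ⟨hx.2, hmem⟩
        omega
      · intro S hS
        simp only [Finset.coe_filter, Finset.mem_filter, Finset.mem_powerset, Set.mem_ofPred_eq,
          Finset.subset_iff, Finset.mem_Icc, Finset.mem_insert] at hS ⊢
        obtain ⟨hsub, hS⟩ := hS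
        refine ⟨⟨?_, ?_⟩, Or.inl trivial⟩
        · rintro x (rfl | hx)
          · omega
          · have := hsub hx
            omega
        · rintro m ⟨h₁ | h₁, h₂ | h₂⟩
          · omega
          · have := hsub h₂
            omega
          · have := hsub h₁
            omega
          · exact hS m ⟨h₁, h₂⟩
      · intro S hS
        exact Finset.insert_erase (Finset.mem_filter.mp hS).2
      · intro S hS
        refine Finset.erase_insert fun h => ?_
        have := Finset.mem_Icc.mp (Finset.mem_powerset.mp (Finset.mem_filter.mp hS).1 h)
        omega
    · congr 1
      ext S
      simp only [Finset.mem_filter, Finset.mem_powerset, Finset.subset_iff, Finset.mem_Icc]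
      constructor
      · rintro ⟨⟨hsub, hS⟩, hmem⟩
        refine ⟨fun x hx => ?_, hS⟩
        have hx' := hsub hx
        have : x ≠ n + 2 := by
          rintro rfl
          exact hmem hx
        omega
      · rintro ⟨hsub, hS⟩
        refine ⟨⟨fun x hx => ?_, hS⟩, fun h => ?_⟩
        · have := hsub hx
          omega
        · have := hsub h
          omega


open Classical in
/-- For every `n ≥ 1`, the number of subsets `S` of `{1, …, n}` that are either
empty or satisfy `min S ≥ |S|` equals the number of subsets of `{1, …, n}`
containing no two consecutive integers. -/
theorem card_weak_schreier_eq_card_zeckendorf (n : ℕ) (hn : 1 ≤ n) :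
    ((Finset.Icc 1 n).powerset.filter
      (fun S => S = ∅ ∨ (S.card : WithTop ℕ) ≤ S.min)).card =
    ((Finset.Icc 1 n).powerset.filter
      (fun S => ∀ m : ℕ, ¬(m ∈ S ∧ m + 1 ∈ S))).card := by
  rw [card_weak_schreier_eq_fib, card_zeckendorf_eq_fib]
end

section
/- Fix an integer k ≥ 2. For n ≥ 1 let H_{k,n} be the number of subsets S of {1, 2, ..., n} such that n ∈ S, min S ≥ |S|, and any two distinct elements of S differ by at least k. Then H_{k,n} = 1 for 1 ≤ n ≤ k+1, and H_{k,n} = H_{k,n-1} + H_{k,n-(k+1)} for all n > k+1. -/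
open Classical in
/-- `schreierZeckendorfWeak k n` is the number of subsets `S` of `{1, …, n}` such
that `n ∈ S`, `min S ≥ |S|` (weak-Schreier), and any two distinct elements of `S`
differ by at least `k` (the `k`-Zeckendorf condition). -/
noncomputable def schreierZeckendorfWeak (k n : ℕ) : ℕ :=
  ((Finset.Icc 1 n).powerset.filter
    (fun S => n ∈ S ∧ (S.card : WithTop ℕ) ≤ S.min ∧
      ∀ a ∈ S, ∀ b ∈ S, a < b → a + k ≤ b)).card

/-- The sets counted by `schreierZeckendorfWeak k n`. -/
def weakSchreierZeckendorfSets (k n : ℕ) : Set (Finset ℕ) :=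
  {S | n ∈ S ∧ (∀ x ∈ S, x ≤ n) ∧ (∀ x ∈ S, S.card ≤ x) ∧
    ∀ a ∈ S, ∀ b ∈ S, a < b → a + k ≤ b}

theorem weakSchreierZeckendorfSets_finite (k n : ℕ) :
    (weakSchreierZeckendorfSets k n).Finite :=
  (Finset.range (n + 1)).powerset.finite_toSet.subset fun S hS => by
    rw [Finset.mem_coe, Finset.mem_powerset]
    exact fun x hx => Finset.mem_range.2 (Nat.lt_succ_of_le (hS.2.1 x hx))

theorem schreierZeckendorfWeak_eq_ncard (k n : ℕ) :
    schreierZeckendorfWeak k n = (weakSchreierZeckendorfSets k n).ncard := by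
  rw [schreierZeckendorfWeak, ← Set.ncard_coe_finset]
  congr 1
  ext S
  -- The decidability instance is explicit: the one in the definition is not the canonical one.
  have mem_filter_iff (s : Finset (Finset ℕ)) (p : Finset ℕ → Prop) (inst : DecidablePred p) :
      S ∈ @Finset.filter _ p inst s ↔ S ∈ s ∧ p S := Finset.mem_filter
  refine Finset.mem_coe.trans ((mem_filter_iff _ _ _).trans ?_)
  rw [Finset.mem_powerset]
  constructor
  · rintro ⟨hS, hn, hmin, hgap⟩
    exact ⟨hn, fun x hx => (Finset.mem_Icc.1 (hS hx)).2,
      fun x hx => WithTop.coe_le_coe.1 (hmin.trans (Finset.min_le hx)), hgap⟩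
  · rintro ⟨hn, hle, hcard, hgap⟩
    refine ⟨fun x hx => Finset.mem_Icc.2 ⟨?_, hle x hx⟩, hn,
      Finset.le_min fun x hx => WithTop.coe_le_coe.2 (hcard x hx), hgap⟩
    exact (Finset.card_pos.2 ⟨n, hn⟩).trans_le (hcard x hx)

theorem weakSchreierZeckendorfSets_eq_singleton {k n : ℕ} (h1 : 1 ≤ n) (hn : n ≤ k + 1) :
    weakSchreierZeckendorfSets k n = {{n}} := by
  ext S
  rw [Set.mem_singleton_iff]
  constructor
  · rintro ⟨hnS, hle, hcard, hgap⟩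
    refine Finset.eq_singleton_iff_unique_mem.2 ⟨hnS, fun x hx => ?_⟩
    by_contra hne
    have h2 : 1 < S.card := Finset.one_lt_card.2 ⟨x, hx, n, hnS, hne⟩
    have := hcard x hx
    have := hgap x hx n hnS (lt_of_le_of_ne (hle x hx) hne)
    omega
  · rintro rfl
    simpa [weakSchreierZeckendorfSets] using h1

/-- Translate `T` by `k + 1` and adjoin the cardinality of the result as a new least element. -/
def shiftInsertCard (k : ℕ) (T : Finset ℕ) : Finset ℕ :=
  insert (T.card + 1) (T.map (addRightEmbedding (k + 1)))

theorem card_succ_notMem_map {k n : ℕ} {T : Finset ℕ} (hk : k ≠ 0)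
    (hT : T ∈ weakSchreierZeckendorfSets k n) :
    T.card + 1 ∉ T.map (addRightEmbedding (k + 1)) := by
  simp only [Finset.mem_map, addRightEmbedding_apply, not_exists, not_and]
  intro x hx h
  have := hT.2.2.1 x hx
  omega

theorem card_shiftInsertCard {k n : ℕ} {T : Finset ℕ} (hk : k ≠ 0)
    (hT : T ∈ weakSchreierZeckendorfSets k n) :
    (shiftInsertCard k T).card = T.card + 1 := by
  rw [shiftInsertCard, Finset.card_insert_of_notMem (card_succ_notMem_map hk hT),
    Finset.card_map]

theorem shiftInsertCard_injOn {k n : ℕ} (hk : k ≠ 0) :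
    Set.InjOn (shiftInsertCard k) (weakSchreierZeckendorfSets k n) := by
  intro T hT U hU h
  have hc : T.card + 1 = U.card + 1 := by
    rw [← card_shiftInsertCard hk hT, ← card_shiftInsertCard hk hU, h]
  have he := congrArg (fun S => S.erase (T.card + 1)) h
  simp only [shiftInsertCard] at he
  rw [Finset.erase_insert (card_succ_notMem_map hk hT), hc,
    Finset.erase_insert (card_succ_notMem_map hk hU)] at he
  exact Finset.map_injective _ he

theorem map_succ_image_weakSchreierZeckendorfSets {k n : ℕ} :
    (Finset.map (addRightEmbedding 1)) '' weakSchreierZeckendorfSets k n =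
      {S ∈ weakSchreierZeckendorfSets k (n + 1) | S.card ∉ S} := by
  ext S
  constructor
  · rintro ⟨T, ⟨hn, hle, hcard, hgap⟩, rfl⟩
    simp only [weakSchreierZeckendorfSets, Set.mem_ofPred_eq, Finset.mem_map,
      addRightEmbedding_apply, Finset.card_map]
    refine ⟨⟨⟨n, hn, rfl⟩, ?_, ?_, ?_⟩, ?_⟩
    · rintro _ ⟨x, hx, rfl⟩
      have := hle x hx
      omega
    · rintro _ ⟨x, hx, rfl⟩
      have := hcard x hx
      omega
    · rintro _ ⟨x, hx, rfl⟩ _ ⟨y, hy, rfl⟩ hxy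
      have := hgap x hx y hy (by omega)
      omega
    · rintro ⟨x, hx, h⟩
      have := hcard x hx
      omega
  · rintro ⟨⟨hn, hle, hcard, hgap⟩, hS⟩
    have hlt : ∀ x ∈ S, S.card < x := fun x hx =>
      lt_of_le_of_ne (hcard x hx) fun h => hS (h ▸ hx)
    have hmap : (S.image (· - 1)).map (addRightEmbedding 1) = S := by
      ext x
      simp only [Finset.mem_map, Finset.mem_image, addRightEmbedding_apply]
      constructor
      · rintro ⟨_, ⟨y, hy, rfl⟩, rfl⟩
        have := hlt y hy
        rwa [Nat.sub_add_cancel (by omega)]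
      · intro hx
        have := hlt x hx
        exact ⟨x - 1, ⟨x, hx, rfl⟩, by omega⟩
    refine ⟨S.image (· - 1), ?_, hmap⟩
    have hc : (S.image (· - 1)).card = S.card := by
      conv_rhs => rw [← hmap, Finset.card_map]
    simp only [weakSchreierZeckendorfSets, Set.mem_ofPred_eq, Finset.mem_image, hc]
    refine ⟨⟨n + 1, hn, rfl⟩, ?_, ?_, ?_⟩
    · rintro _ ⟨x, hx, rfl⟩
      have := hle x hx
      omega
    · rintro _ ⟨x, hx, rfl⟩
      have := hlt x hx
      omega
    · rintro _ ⟨x, hx, rfl⟩ _ ⟨y, hy, rfl⟩ hxy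
      have := hgap x hx y hy (by omega)
      have := hlt x hx
      omega

theorem shiftInsertCard_image_weakSchreierZeckendorfSets {k n : ℕ} (hk : k ≠ 0) :
    shiftInsertCard k '' weakSchreierZeckendorfSets k n =
      {S ∈ weakSchreierZeckendorfSets k (n + (k + 1)) | S.card ∈ S} := by
  ext S
  constructor
  · rintro ⟨T, hT, rfl⟩
    have hc := card_shiftInsertCard hk hT
    obtain ⟨hn, hle, hcard, hgap⟩ := hT
    have hmem : ∀ x, x ∈ shiftInsertCard k T ↔ x = T.card + 1 ∨ ∃ y ∈ T, y + (k + 1) = x := by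
      simp [shiftInsertCard]
    simp only [weakSchreierZeckendorfSets, Set.mem_ofPred_eq, hc, hmem]
    refine ⟨⟨Or.inr ⟨n, hn, rfl⟩, ?_, ?_, ?_⟩, by simp⟩
    · rintro _ (rfl | ⟨x, hx, rfl⟩)
      · have := hcard n hn
        omega
      · have := hle x hx
        omega
    · rintro _ (rfl | ⟨x, hx, rfl⟩)
      · exact le_rfl
      · have := hcard x hx
        omega
    · rintro _ (rfl | ⟨x, hx, rfl⟩) _ (rfl | ⟨y, hy, rfl⟩) hxy
      · omega
      · have := hcard y hy
        omega
      · have := hcard x hx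
        omega
      · have := hgap x hx y hy (by omega)
        omega
  · rintro ⟨⟨hn, hle, hcard, hgap⟩, hS⟩
    have hpos : 0 < S.card := Finset.card_pos.2 ⟨_, hS⟩
    have hlt : ∀ x ∈ S.erase S.card, S.card + k ≤ x := fun x hx =>
      hgap _ hS x (Finset.mem_of_mem_erase hx)
        (lt_of_le_of_ne (hcard x (Finset.mem_of_mem_erase hx)) (Finset.ne_of_mem_erase hx).symm)
    have hmap : ((S.erase S.card).image (· - (k + 1))).map (addRightEmbedding (k + 1)) =
        S.erase S.card := by
      ext x
      simp only [Finset.mem_map, Finset.mem_image, addRightEmbedding_apply]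
      constructor
      · rintro ⟨_, ⟨y, hy, rfl⟩, rfl⟩
        have := hlt y hy
        rwa [Nat.sub_add_cancel (by omega)]
      · intro hx
        have := hlt x hx
        exact ⟨x - (k + 1), ⟨x, hx, rfl⟩, by omega⟩
    have hc : ((S.erase S.card).image (· - (k + 1))).card + 1 = S.card := by
      rw [← Finset.card_map (addRightEmbedding (k + 1)), hmap, Finset.card_erase_add_one hS]
    refine ⟨(S.erase S.card).image (· - (k + 1)), ?_, ?_⟩
    · have hne : n + (k + 1) ≠ S.card := by
        intro h
        have h1 : S = {S.card} := Finset.eq_singleton_iff_unique_mem.2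
          ⟨hS, fun x hx => le_antisymm (h ▸ hle x hx) (hcard x hx)⟩
        have h2 : S.card = 1 := by rw [h1, Finset.card_singleton]
        omega
      simp only [weakSchreierZeckendorfSets, Set.mem_ofPred_eq]
      refine ⟨Finset.mem_image.2
        ⟨n + (k + 1), Finset.mem_erase.2 ⟨hne, hn⟩, by simp⟩, ?_, ?_, ?_⟩ <;>
        simp only [Finset.mem_image]
      · rintro _ ⟨x, hx, rfl⟩
        have := hle x (Finset.mem_of_mem_erase hx)
        omega
      · rintro _ ⟨x, hx, rfl⟩
        have := hlt x hx
        omega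
      · rintro _ ⟨x, hx, rfl⟩ _ ⟨y, hy, rfl⟩ hxy
        have := hgap x (Finset.mem_of_mem_erase hx) y (Finset.mem_of_mem_erase hy) (by omega)
        have := hlt x hx
        omega
    · rw [shiftInsertCard, hc, hmap, Finset.insert_erase hS]


/-- Fix `k ≥ 2`. Then `H_{k,n} = 1` for `1 ≤ n ≤ k+1` and
`H_{k,n} = H_{k,n-1} + H_{k,n-(k+1)}` for all `n > k+1`. -/
theorem schreierZeckendorfWeak_recurrence (k : ℕ) (hk : 2 ≤ k) :
    (∀ n : ℕ, 1 ≤ n → n ≤ k + 1 → schreierZeckendorfWeak k n = 1) ∧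
    (∀ n : ℕ, k + 1 < n →
      schreierZeckendorfWeak k n =
        schreierZeckendorfWeak k (n - 1) + schreierZeckendorfWeak k (n - (k + 1))) := by
  have hk0 : k ≠ 0 := by omega
  refine ⟨fun n h1 hn => ?_, fun n hn => ?_⟩
  · rw [schreierZeckendorfWeak_eq_ncard, weakSchreierZeckendorfSets_eq_singleton h1 hn,
      Set.ncard_singleton]
  · have hshift := map_succ_image_weakSchreierZeckendorfSets (k := k) (n := n - 1)
    have hinsert := shiftInsertCard_image_weakSchreierZeckendorfSets (n := n - (k + 1)) hk0
    rw [Nat.sub_add_cancel (by omega)] at hshift hinsert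
    simp only [schreierZeckendorfWeak_eq_ncard]
    rw [← Set.ncard_image_of_injective (weakSchreierZeckendorfSets k (n - 1))
        (Finset.map_injective (addRightEmbedding 1)),
      ← (shiftInsertCard_injOn (n := n - (k + 1)) hk0).ncard_image, hshift, hinsert,
      ← Set.ncard_union_eq ?_ ((weakSchreierZeckendorfSets_finite k n).subset (Set.sep_subset _ _))
        ((weakSchreierZeckendorfSets_finite k n).subset (Set.sep_subset _ _))]
    · congr 1
      ext S
      simp only [Set.mem_union, Set.mem_sep_iff]
      tauto
    · exact Set.disjoint_left.2 fun S h h' => h.2 h'.2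
end

section
/- Fix an integer k ≥ 2. For n ≥ 1 let I_{k,n} be the number of subsets S of {1, 2, ..., n} such that n ∈ S, min S > |S|, and any two distinct elements of S differ by at least k. Then I_{k,1} = 0, I_{k,n} = 1 for 2 ≤ n ≤ k+2, and I_{k,n} = I_{k,n-1} + I_{k,n-(k+1)} for all n > k+2. -/
open Classical in
/-- `schreierZeckendorfStrong k n` is the number of subsets `S` of `{1, …, n}` such
that `n ∈ S`, `min S > |S|` (strong-Schreier), and any two distinct elements of `S`
differ by at least `k` (the `k`-Zeckendorf condition). -/
noncomputable def schreierZeckendorfStrong (k n : ℕ) : ℕ :=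
  ((Finset.Icc 1 n).powerset.filter
    (fun S => n ∈ S ∧ (S.card : WithTop ℕ) < S.min ∧
      ∀ a ∈ S, ∀ b ∈ S, a < b → a + k ≤ b)).card

open Classical in
/-- The family of sets counted by `schreierZeckendorfStrong k n`. -/
noncomputable def schreierZeckendorfFamily (k n : ℕ) : Finset (Finset ℕ) :=
  (Finset.Icc 1 n).powerset.filter
    (fun S => n ∈ S ∧ (S.card : WithTop ℕ) < S.min ∧
      ∀ a ∈ S, ∀ b ∈ S, a < b → a + k ≤ b)

theorem card_schreierZeckendorfFamily (k n : ℕ) :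
    (schreierZeckendorfFamily k n).card = schreierZeckendorfStrong k n := by
  rw [schreierZeckendorfStrong, schreierZeckendorfFamily]
  congr!

theorem mem_schreierZeckendorfFamily {k n : ℕ} {S : Finset ℕ} :
    S ∈ schreierZeckendorfFamily k n ↔
      n ∈ S ∧ (∀ a ∈ S, a ≤ n) ∧ (∀ a ∈ S, S.card < a) ∧
        ∀ a ∈ S, ∀ b ∈ S, a < b → a + k ≤ b := by
  have hmin : (S.card : WithTop ℕ) < S.min ↔ ∀ a ∈ S, S.card < a := by
    refine (Finset.lt_inf_iff (WithTop.coe_lt_top S.card)).trans ?_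
    exact forall₂_congr fun a _ => WithTop.coe_lt_coe
  simp only [schreierZeckendorfFamily, Finset.mem_filter, Finset.mem_powerset, hmin,
    Finset.subset_iff, Finset.mem_Icc]
  constructor
  · rintro ⟨h1, h2, h3, h4⟩
    exact ⟨h2, fun a ha => (h1 ha).2, h3, h4⟩
  · rintro ⟨h1, h2, h3, h4⟩
    exact ⟨fun a ha => ⟨Nat.one_le_of_lt (h3 a ha), h2 a ha⟩, h1, h3, h4⟩

theorem card_insert_erase_of_mem {S : Finset ℕ} {a b : ℕ} (ha : a ∈ S) (hb : b ∉ S) :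
    (insert b (S.erase a)).card = S.card := by
  rw [Finset.card_insert_of_notMem (fun h => hb (Finset.mem_of_mem_erase h)),
    Finset.card_erase_add_one ha]

/-- Lowering the maximum by one identifies the sets with maximum `m + k + 1` that avoid `m + 1`
with the sets with maximum `m + k`. -/
theorem card_filter_notMem_schreierZeckendorfFamily {k m : ℕ} (hk : 2 ≤ k) (hm : 2 ≤ m) :
    ((schreierZeckendorfFamily k (m + k + 1)).filter (fun S => ¬ m + 1 ∈ S)).card =
      (schreierZeckendorfFamily k (m + k)).card := by
  refine Finset.card_nbij' (fun S => insert (m + k) (S.erase (m + k + 1)))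
    (fun T => insert (m + k + 1) (T.erase (m + k))) ?_ ?_ ?_ ?_
  · intro S hS
    simp only [Finset.coe_filter, Set.mem_ofPred_eq, Finset.mem_coe,
      mem_schreierZeckendorfFamily] at hS ⊢
    obtain ⟨⟨h1, h2, h3, h4⟩, h5⟩ := hS
    have hnot : m + k ∉ S := fun h => by have := h4 _ h _ h1 (by omega); omega
    have hlow : ∀ a ∈ S, a ≠ m + k + 1 → a ≤ m := fun a ha hne => by
      have := h4 a ha _ h1 (by have := h2 a ha; omega)
      have : a ≠ m + 1 := fun h => h5 (h ▸ ha)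
      omega
    have hcard : S.card < m + k := by
      by_cases hS : ∃ a ∈ S, a ≠ m + k + 1
      · obtain ⟨a, ha, hne⟩ := hS
        have := hlow a ha hne
        have := h3 a ha
        omega
      · push Not at hS
        have : S.card ≤ 1 := Finset.card_le_one.2 fun a ha b hb => by rw [hS a ha, hS b hb]
        omega
    rw [card_insert_erase_of_mem h1 hnot]
    simp only [Finset.mem_insert, Finset.mem_erase]
    refine ⟨Or.inl trivial, ?_, ?_, ?_⟩
    · rintro a (rfl | ⟨hne, ha⟩)
      · exact le_rfl
      · have := hlow a ha hne
        omega
    · rintro a (rfl | ⟨hne, ha⟩)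
      · exact hcard
      · exact h3 a ha
    · rintro a (rfl | ⟨hne, ha⟩) b (rfl | ⟨hne', hb⟩) hab
      · omega
      · have := hlow b hb hne'
        omega
      · have := hlow a ha hne
        omega
      · exact h4 a ha b hb hab
  · intro T hT
    simp only [Finset.coe_filter, Set.mem_ofPred_eq, Finset.mem_coe,
      mem_schreierZeckendorfFamily] at hT ⊢
    obtain ⟨h1, h2, h3, h4⟩ := hT
    have hnot : m + k + 1 ∉ T := fun h => by have := h2 _ h; omega
    have hlow : ∀ a ∈ T, a ≠ m + k → a ≤ m := fun a ha hne => by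
      have := h4 a ha _ h1 (by have := h2 a ha; omega)
      omega
    have := h3 _ h1
    rw [card_insert_erase_of_mem h1 hnot]
    simp only [Finset.mem_insert, Finset.mem_erase]
    refine ⟨⟨Or.inl trivial, ?_, ?_, ?_⟩, ?_⟩
    · rintro a (rfl | ⟨hne, ha⟩)
      · exact le_rfl
      · have := h2 a ha
        omega
    · rintro a (rfl | ⟨hne, ha⟩)
      · omega
      · exact h3 a ha
    · rintro a (rfl | ⟨hne, ha⟩) b (rfl | ⟨hne', hb⟩) hab
      · omega
      · have := h2 b hb
        omega
      · have := hlow a ha hne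
        omega
      · exact h4 a ha b hb hab
    · rintro (h | ⟨hne, ha⟩)
      · omega
      · have := hlow _ ha hne
        omega
  · intro S hS
    simp only [Finset.coe_filter, Set.mem_ofPred_eq, mem_schreierZeckendorfFamily] at hS
    obtain ⟨⟨h1, h2, h3, h4⟩, h5⟩ := hS
    have hnot : m + k ∉ S := fun h => by have := h4 _ h _ h1 (by omega); omega
    ext a
    simp only [Finset.mem_insert, Finset.mem_erase]
    grind
  · intro T hT
    simp only [Finset.mem_coe, mem_schreierZeckendorfFamily] at hT
    obtain ⟨h1, h2, h3, h4⟩ := hT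
    have hnot : m + k + 1 ∉ T := fun h => by have := h2 _ h; omega
    ext a
    simp only [Finset.mem_insert, Finset.mem_erase]
    grind

/-- Deleting the maximum and shifting down by one identifies the sets with maximum `m + k + 1`
that contain `m + 1` with the sets with maximum `m`. -/
theorem card_filter_mem_schreierZeckendorfFamily {k m : ℕ} (hk : 2 ≤ k) :
    ((schreierZeckendorfFamily k (m + k + 1)).filter (fun S => m + 1 ∈ S)).card =
      (schreierZeckendorfFamily k m).card := by
  refine Finset.card_nbij' (fun S => (S.erase (m + k + 1)).image (· - 1))
    (fun T => insert (m + k + 1) (T.image (· + 1))) ?_ ?_ ?_ ?_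
  · intro S hS
    simp only [Finset.coe_filter, Set.mem_ofPred_eq, Finset.mem_coe,
      mem_schreierZeckendorfFamily] at hS ⊢
    obtain ⟨⟨h1, h2, h3, h4⟩, h5⟩ := hS
    have hcard : ((S.erase (m + k + 1)).image (· - 1)).card + 1 = S.card := by
      rw [Finset.card_image_of_injOn, Finset.card_erase_add_one h1]
      intro a ha b hb hab
      have := h3 a (Finset.mem_of_mem_erase ha)
      have := h3 b (Finset.mem_of_mem_erase hb)
      dsimp only at hab
      omega
    refine ⟨Finset.mem_image.2 ⟨m + 1, Finset.mem_erase.2 ⟨by omega, h5⟩, rfl⟩, ?_, ?_, ?_⟩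
    · simp only [Finset.mem_image, Finset.mem_erase]
      rintro _ ⟨a, ⟨hne, ha⟩, rfl⟩
      have := h4 a ha _ h1 (by have := h2 a ha; omega)
      omega
    · intro b hb
      simp only [Finset.mem_image, Finset.mem_erase] at hb
      obtain ⟨a, ⟨hne, ha⟩, rfl⟩ := hb
      have := h3 a ha
      omega
    · simp only [Finset.mem_image, Finset.mem_erase]
      rintro _ ⟨a, ⟨hne, ha⟩, rfl⟩ _ ⟨b, ⟨hne', hb⟩, rfl⟩ hab
      have := h4 a ha b hb (by omega)
      have := h3 a ha
      omega
  · intro T hT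
    simp only [Finset.coe_filter, Set.mem_ofPred_eq, Finset.mem_coe,
      mem_schreierZeckendorfFamily] at hT ⊢
    obtain ⟨h1, h2, h3, h4⟩ := hT
    have hnot : m + k + 1 ∉ T.image (· + 1) := fun h => by
      obtain ⟨a, ha, hab⟩ := Finset.mem_image.1 h
      have := h2 a ha
      omega
    have := h3 _ h1
    rw [Finset.card_insert_of_notMem hnot,
      Finset.card_image_of_injective _ (add_left_injective 1)]
    simp only [Finset.mem_insert, Finset.mem_image]
    refine ⟨⟨Or.inl trivial, ?_, ?_, ?_⟩, Or.inr ⟨m, h1, rfl⟩⟩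
    · rintro _ (rfl | ⟨a, ha, rfl⟩)
      · exact le_rfl
      · have := h2 a ha
        omega
    · rintro _ (rfl | ⟨a, ha, rfl⟩)
      · omega
      · have := h3 a ha
        omega
    · rintro _ (rfl | ⟨a, ha, rfl⟩) _ (rfl | ⟨b, hb, rfl⟩) hab
      · omega
      · have := h2 b hb
        omega
      · have := h2 a ha
        omega
      · have := h4 a ha b hb (by omega)
        omega
  · intro S hS
    simp only [Finset.coe_filter, Set.mem_ofPred_eq, mem_schreierZeckendorfFamily] at hS
    obtain ⟨⟨h1, h2, h3, h4⟩, h5⟩ := hS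
    have hid : ((S.erase (m + k + 1)).image (· - 1)).image (· + 1) = S.erase (m + k + 1) := by
      rw [Finset.image_image]
      refine (Finset.image_congr fun a ha => ?_).trans Finset.image_id
      have := h3 a (Finset.mem_of_mem_erase ha)
      simp only [Function.comp_apply, id_eq]
      omega
    dsimp only
    rw [hid, Finset.insert_erase h1]
  · intro T hT
    simp only [Finset.mem_coe, mem_schreierZeckendorfFamily] at hT
    obtain ⟨h1, h2, h3, h4⟩ := hT
    have hnot : m + k + 1 ∉ T.image (· + 1) := fun h => by
      obtain ⟨a, ha, hab⟩ := Finset.mem_image.1 h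
      have := h2 a ha
      omega
    dsimp only
    rw [Finset.erase_insert hnot, Finset.image_image]
    exact (Finset.image_congr fun a _ => Nat.add_sub_cancel a 1).trans Finset.image_id

theorem schreierZeckendorfFamily_one (k : ℕ) : schreierZeckendorfFamily k 1 = ∅ := by
  refine Finset.eq_empty_of_forall_notMem fun S hS => ?_
  obtain ⟨h1, -, h3, -⟩ := mem_schreierZeckendorfFamily.1 hS
  have := h3 1 h1
  have := Finset.card_pos.2 ⟨1, h1⟩
  omega

theorem schreierZeckendorfFamily_eq_singleton {k n : ℕ} (hn : 2 ≤ n) (hnk : n ≤ k + 2) :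
    schreierZeckendorfFamily k n = {{n}} := by
  ext S
  rw [mem_schreierZeckendorfFamily, Finset.mem_singleton]
  constructor
  · rintro ⟨h1, h2, h3, h4⟩
    refine Finset.eq_singleton_iff_unique_mem.2 ⟨h1, fun a ha => ?_⟩
    by_contra hne
    have := h4 a ha n h1 (lt_of_le_of_ne (h2 a ha) hne)
    have := h3 a ha
    have := Finset.one_lt_card.2 ⟨a, ha, n, h1, hne⟩
    omega
  · rintro rfl
    simp only [Finset.mem_singleton, Finset.card_singleton]
    grind

/-- Fix `k ≥ 2`. Then `I_{k,1} = 0`, `I_{k,n} = 1` for `2 ≤ n ≤ k+2`, and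
`I_{k,n} = I_{k,n-1} + I_{k,n-(k+1)}` for all `n > k+2`. -/
theorem schreierZeckendorfStrong_recurrence (k : ℕ) (hk : 2 ≤ k) :
    schreierZeckendorfStrong k 1 = 0 ∧
    (∀ n : ℕ, 2 ≤ n → n ≤ k + 2 → schreierZeckendorfStrong k n = 1) ∧
    (∀ n : ℕ, k + 2 < n →
      schreierZeckendorfStrong k n =
        schreierZeckendorfStrong k (n - 1) + schreierZeckendorfStrong k (n - (k + 1))) := by
  simp only [← card_schreierZeckendorfFamily]
  refine ⟨?_, fun n hn hnk => ?_, fun n hn => ?_⟩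
  · rw [schreierZeckendorfFamily_one, Finset.card_empty]
  · rw [schreierZeckendorfFamily_eq_singleton hn hnk, Finset.card_singleton]
  · obtain ⟨m, rfl⟩ : ∃ m, n = m + k + 1 := ⟨n - (k + 1), by omega⟩
    rw [show m + k + 1 - 1 = m + k by omega, show m + k + 1 - (k + 1) = m by omega,
      ← card_filter_notMem_schreierZeckendorfFamily hk (by omega : 2 ≤ m),
      ← card_filter_mem_schreierZeckendorfFamily (m := m) hk, Nat.add_comm (Finset.card _),
      Finset.card_filter_add_card_filter_not]
end

section
/- Fix an integer k ≥ 2. For n ≥ 1 let J_{k,n} be the number of subsets S of {1, 2, ..., n} such that n ∈ S, min S = |S|, and any two distinct elements of S differ by at least k. Then J_{k,1} = 1, J_{k,n} = 0 for 2 ≤ n ≤ k+1, J_{k,n} = 1 for k+1 < n ≤ 2k+2, and J_{k,n} = J_{k,n-1} + J_{k,n-(k+1)} for all n > 2k+2. -/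
open Classical in
/-- `schreierZeckendorfMaximal k n` is the number of subsets `S` of `{1, …, n}` such
that `n ∈ S`, `min S = |S|` (maximal Schreier), and any two distinct elements of `S`
differ by at least `k` (the `k`-Zeckendorf condition). -/
noncomputable def schreierZeckendorfMaximal (k n : ℕ) : ℕ :=
  ((Finset.Icc 1 n).powerset.filter
    (fun S => n ∈ S ∧ S.min = (S.card : WithTop ℕ) ∧
      ∀ a ∈ S, ∀ b ∈ S, a < b → a + k ≤ b)).card

/-- `S` has maximum `n`, minimum `|S|`, and its distinct elements differ by at least `k`. -/
def IsMaximalSchreierZeckendorf (k n : ℕ) (S : Finset ℕ) : Prop :=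
  n ∈ S ∧ (∀ x ∈ S, x ≤ n) ∧ S.card ∈ S ∧ (∀ x ∈ S, S.card ≤ x) ∧
    ∀ a ∈ S, ∀ b ∈ S, a < b → a + k ≤ b

theorem finset_min_eq_coe_iff {S : Finset ℕ} {m : ℕ} :
    S.min = (m : WithTop ℕ) ↔ m ∈ S ∧ ∀ x ∈ S, m ≤ x := by
  constructor
  · intro h
    exact ⟨Finset.mem_of_min h, fun x hx => Finset.min_le_of_eq hx h⟩
  · rintro ⟨h, h'⟩
    exact le_antisymm (Finset.min_le h) (Finset.le_min fun x hx => WithTop.coe_le_coe.2 (h' x hx))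

open Classical in
/-- The finite family of sets counted by `schreierZeckendorfMaximal k n`. -/
noncomputable def maximalFamily (k n : ℕ) : Finset (Finset ℕ) :=
  (Finset.Icc 1 n).powerset.filter (IsMaximalSchreierZeckendorf k n)

theorem mem_maximalFamily {k n : ℕ} {S : Finset ℕ} :
    S ∈ maximalFamily k n ↔ IsMaximalSchreierZeckendorf k n S := by
  classical
  simp only [maximalFamily, Finset.mem_filter, Finset.mem_powerset, and_iff_right_iff_imp]
  rintro ⟨hn, hle, -, hmin, -⟩ x hx
  have := Finset.card_pos.2 ⟨n, hn⟩
  exact Finset.mem_Icc.2 ⟨this.trans_le (hmin x hx), hle x hx⟩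

theorem schreierZeckendorfMaximal_eq_card (k n : ℕ) :
    schreierZeckendorfMaximal k n = (maximalFamily k n).card := by
  classical
  unfold schreierZeckendorfMaximal maximalFamily
  congr 1
  ext S
  simp only [Finset.mem_filter, Finset.mem_powerset, finset_min_eq_coe_iff,
    IsMaximalSchreierZeckendorf]
  constructor
  · rintro ⟨hS, hn, ⟨hc, hmin⟩, hgap⟩
    exact ⟨hS, hn, fun x hx => (Finset.mem_Icc.1 (hS hx)).2, hc, hmin, hgap⟩
  · rintro ⟨hS, hn, -, hc, hmin, hgap⟩
    exact ⟨hS, hn, ⟨hc, hmin⟩, hgap⟩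

namespace IsMaximalSchreierZeckendorf

variable {k n : ℕ} {S : Finset ℕ}

theorem card_lt (h : IsMaximalSchreierZeckendorf k n S) (hn : 1 < n) : S.card < n := by
  obtain ⟨hnS, hle, hc, hmin, -⟩ := h
  refine lt_of_le_of_ne (hle _ hc) fun he => ?_
  have hS : S = {n} := Finset.eq_singleton_iff_unique_mem.2
    ⟨hnS, fun x hx => le_antisymm (hle x hx) (he ▸ hmin x hx)⟩
  rw [hS, Finset.card_singleton] at he
  omega

theorem two_le_card (h : IsMaximalSchreierZeckendorf k n S) (hn : 1 < n) : 2 ≤ S.card :=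
  Finset.one_lt_card.2 ⟨_, h.2.2.1, _, h.1, (h.card_lt hn).ne⟩

theorem card_add_le (h : IsMaximalSchreierZeckendorf k n S) (hn : 1 < n) : S.card + k ≤ n :=
  h.2.2.2.2 _ h.2.2.1 _ h.1 (h.card_lt hn)

theorem replace_max {m : ℕ} (h : IsMaximalSchreierZeckendorf k n S) (hn : 1 < n)
    (hm : ∀ x ∈ S, x ≠ n → x + k ≤ m ∧ x < m) :
    IsMaximalSchreierZeckendorf k m (insert m (S.erase n)) := by
  have hlt := h.card_lt hn
  obtain ⟨hnS, hle, hc, hmin, hgap⟩ := h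
  have hmS : m ∉ S.erase n := fun hx =>
    (hm m (Finset.mem_of_mem_erase hx) (Finset.ne_of_mem_erase hx)).2.false
  have hcard : (insert m (S.erase n)).card = S.card := by
    rw [Finset.card_insert_of_notMem hmS, Finset.card_erase_add_one hnS]
  have hcm := hm _ hc hlt.ne
  simp only [IsMaximalSchreierZeckendorf, hcard, Finset.mem_insert, Finset.mem_erase]
  refine ⟨Or.inl trivial, ?_, Or.inr ⟨hlt.ne, hc⟩, ?_, ?_⟩
  · rintro x (rfl | ⟨hx, hxS⟩)
    exacts [le_rfl, (hm x hxS hx).2.le]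
  · rintro x (rfl | ⟨hx, hxS⟩)
    exacts [hcm.2.le, hmin x hxS]
  · rintro a (rfl | ⟨ha, haS⟩) b (rfl | ⟨hb, hbS⟩) hab
    · omega
    · have := hm b hbS hb
      omega
    · exact (hm a haS ha).1
    · exact hgap a haS b hbS hab

theorem insert_shift (hk : 1 ≤ k) (h : IsMaximalSchreierZeckendorf k n S) :
    IsMaximalSchreierZeckendorf k (n + (k + 1))
      (insert (n + (k + 1)) (S.image (· + 1))) := by
  obtain ⟨hnS, hle, hc, hmin, hgap⟩ := h
  have hnot : n + (k + 1) ∉ S.image (· + 1) := by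
    simp only [Finset.mem_image, not_exists, not_and]
    intro x hx
    have := hle x hx
    omega
  have hcard : (insert (n + (k + 1)) (S.image (· + 1))).card = S.card + 1 := by
    rw [Finset.card_insert_of_notMem hnot,
      Finset.card_image_of_injective _ (add_left_injective 1)]
  simp only [IsMaximalSchreierZeckendorf, hcard, Finset.mem_insert, Finset.mem_image]
  refine ⟨Or.inl trivial, ?_, Or.inr ⟨_, hc, rfl⟩, ?_, ?_⟩
  · rintro _ (rfl | ⟨x, hx, rfl⟩)
    · exact le_rfl
    · have := hle x hx
      omega
  · have := hle _ hc
    rintro _ (rfl | ⟨x, hx, rfl⟩)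
    · omega
    · have := hmin x hx
      omega
  · rintro _ (rfl | ⟨x, hx, rfl⟩) _ (rfl | ⟨y, hy, rfl⟩) hab
    · omega
    · have := hle y hy
      omega
    · have := hle x hx
      omega
    · have := hgap x hx y hy (by omega)
      omega

theorem exists_eq_insert_shift (hk : 1 ≤ k)
    (h : IsMaximalSchreierZeckendorf k (n + (k + 1)) S) (hS : n + 1 ∈ S) :
    ∃ T, IsMaximalSchreierZeckendorf k n T ∧
      insert (n + (k + 1)) (T.image (· + 1)) = S := by
  have hlt := h.card_lt (by omega)
  have htwo := h.two_le_card (by omega)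
  obtain ⟨hnS, hle, hc, hmin, hgap⟩ := h
  have hcard : ((S.erase (n + (k + 1))).image (· - 1)).card = S.card - 1 := by
    rw [Finset.card_image_of_injOn, Finset.card_erase_of_mem hnS]
    intro x hx y hy hxy
    have hx' := hmin x (Finset.mem_of_mem_erase hx)
    have hy' := hmin y (Finset.mem_of_mem_erase hy)
    simp only at hxy
    omega
  refine ⟨(S.erase (n + (k + 1))).image (· - 1), ?_, ?_⟩
  · simp only [IsMaximalSchreierZeckendorf, hcard, Finset.mem_image, Finset.mem_erase]
    refine ⟨⟨n + 1, ⟨by omega, hS⟩, by omega⟩, ?_, ⟨S.card, ⟨hlt.ne, hc⟩, rfl⟩, ?_, ?_⟩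
    · rintro _ ⟨x, ⟨hx, hxS⟩, rfl⟩
      have := hgap x hxS _ hnS (lt_of_le_of_ne (hle x hxS) hx)
      omega
    · rintro _ ⟨x, ⟨-, hxS⟩, rfl⟩
      have := hmin x hxS
      omega
    · rintro _ ⟨x, ⟨-, hx⟩, rfl⟩ _ ⟨y, ⟨-, hy⟩, rfl⟩ hxy
      have := hgap x hx y hy (by omega)
      have := hmin x hx
      omega
  · have hid : ((S.erase (n + (k + 1))).image (· - 1)).image (· + 1) =
        S.erase (n + (k + 1)) := by
      rw [Finset.image_image]
      conv_rhs => rw [← Finset.image_id (s := S.erase (n + (k + 1)))]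
      refine Finset.image_congr fun x hx => ?_
      have := hmin x (Finset.mem_of_mem_erase hx)
      simp only [Function.comp_apply, id]
      omega
    rw [hid, Finset.insert_erase hnS]

theorem eq_pair (h : IsMaximalSchreierZeckendorf k n S) (hn : 1 < n) (hn' : n ≤ 2 * k + 2) :
    S = {2, n} := by
  have hlt := h.card_lt hn
  have htwo := h.two_le_card hn
  obtain ⟨hnS, hle, hc, hmin, hgap⟩ := h
  have hcard : S.card = 2 := by
    refine le_antisymm ?_ htwo
    by_contra! hlarge
    have hsub : S ⊆ {S.card, n} := by
      intro x hx
      by_contra hne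
      simp only [Finset.mem_insert, Finset.mem_singleton, not_or] at hne
      have h₁ := hgap _ hc x hx (lt_of_le_of_ne (hmin x hx) (Ne.symm hne.1))
      have h₂ := hgap x hx n hnS (lt_of_le_of_ne (hle x hx) hne.2)
      omega
    have := (Finset.card_le_card hsub).trans Finset.card_le_two
    omega
  rw [hcard] at hc hlt
  refine (Finset.eq_of_subset_of_card_le ?_ ?_).symm
  · simp [Finset.insert_subset_iff, hc, hnS]
  · rw [hcard, Finset.card_pair hlt.ne]

end IsMaximalSchreierZeckendorf

theorem maximalFamily_one (k : ℕ) : maximalFamily k 1 = {{1}} := by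
  ext S
  rw [mem_maximalFamily, Finset.mem_singleton]
  constructor
  · rintro ⟨h1, hle, hc, hmin, -⟩
    have := Finset.card_pos.2 ⟨1, h1⟩
    exact Finset.eq_singleton_iff_unique_mem.2
      ⟨h1, fun x hx => le_antisymm (hle x hx) (this.trans_le (hmin x hx))⟩
  · rintro rfl
    simp [IsMaximalSchreierZeckendorf]

theorem maximalFamily_eq_empty {k n : ℕ} (hn : 1 < n) (hn' : n ≤ k + 1) :
    maximalFamily k n = ∅ := by
  refine Finset.eq_empty_of_forall_notMem fun S hS => ?_
  rw [mem_maximalFamily] at hS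
  have := hS.card_add_le hn
  have := hS.two_le_card hn
  omega

theorem maximalFamily_eq_pair {k n : ℕ} (hk : 1 ≤ k) (hn : k + 1 < n) (hn' : n ≤ 2 * k + 2) :
    maximalFamily k n = {{2, n}} := by
  ext S
  rw [mem_maximalFamily, Finset.mem_singleton]
  refine ⟨fun h => h.eq_pair (by omega) hn', ?_⟩
  rintro rfl
  have hcard : ({2, n} : Finset ℕ).card = 2 := Finset.card_pair (by omega)
  simp only [IsMaximalSchreierZeckendorf, hcard, Finset.mem_insert, Finset.mem_singleton]
  grind

open Classical in
theorem card_filter_notMem_maximalFamily {k n : ℕ} (hk : 1 ≤ k) (hn : 1 < n) :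
    ((maximalFamily k (n + 1)).filter fun S => n + 1 - k ∉ S).card =
      (maximalFamily k n).card := by
  have hlt {S : Finset ℕ} (h : IsMaximalSchreierZeckendorf k (n + 1) S) (hS : n + 1 - k ∉ S) :
      ∀ x ∈ S, x ≠ n + 1 → x + k ≤ n ∧ x < n := by
    intro x hx hne
    have h₁ := h.2.2.2.2 x hx _ h.1 (lt_of_le_of_ne (h.2.1 x hx) hne)
    have h₂ : x ≠ n + 1 - k := fun he => hS (he ▸ hx)
    omega
  have hlt' {S : Finset ℕ} (h : IsMaximalSchreierZeckendorf k n S) :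
      ∀ x ∈ S, x ≠ n → x + k ≤ n ∧ x < n := by
    intro x hx hne
    have h₁ := h.2.2.2.2 x hx _ h.1 (lt_of_le_of_ne (h.2.1 x hx) hne)
    omega
  refine Finset.card_bij' (fun S _ => insert n (S.erase (n + 1)))
    (fun T _ => insert (n + 1) (T.erase n)) ?_ ?_ ?_ ?_
  · intro S hS
    rw [Finset.mem_filter, mem_maximalFamily] at hS
    exact mem_maximalFamily.2 (hS.1.replace_max (by omega) (hlt hS.1 hS.2))
  · intro T hT
    rw [mem_maximalFamily] at hT
    rw [Finset.mem_filter, mem_maximalFamily]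
    refine ⟨hT.replace_max hn fun x hx hne => ?_, fun hmem => ?_⟩
    · have := hlt' hT x hx hne
      omega
    · rw [Finset.mem_insert, Finset.mem_erase] at hmem
      have hc := hT.card_add_le hn
      rcases hmem with hmem | ⟨hne, hmem⟩
      · omega
      · have := hlt' hT _ hmem hne
        omega
  · intro S hS
    rw [Finset.mem_filter, mem_maximalFamily] at hS
    have hnS : n ∉ S.erase (n + 1) := fun hx =>
      (hlt hS.1 hS.2 n (Finset.mem_of_mem_erase hx) (Finset.ne_of_mem_erase hx)).2.false
    rw [Finset.erase_insert hnS, Finset.insert_erase hS.1.1]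
  · intro T hT
    rw [mem_maximalFamily] at hT
    have hnT : n + 1 ∉ T.erase n := fun hx =>
      absurd (hT.2.1 _ (Finset.mem_of_mem_erase hx)) (by omega)
    rw [Finset.erase_insert hnT, Finset.insert_erase hT.1]

open Classical in
theorem card_filter_mem_maximalFamily {k n : ℕ} (hk : 1 ≤ k) :
    ((maximalFamily k (n + (k + 1))).filter fun S => n + 1 ∈ S).card =
      (maximalFamily k n).card := by
  symm
  refine Finset.card_bij (fun T _ => insert (n + (k + 1)) (T.image (· + 1))) ?_ ?_ ?_
  · intro T hT
    rw [mem_maximalFamily] at hT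
    rw [Finset.mem_filter, mem_maximalFamily]
    exact ⟨hT.insert_shift hk,
      Finset.mem_insert_of_mem (Finset.mem_image_of_mem (· + 1) hT.1)⟩
  · have hnot {T : Finset ℕ} (hT : T ∈ maximalFamily k n) :
        n + (k + 1) ∉ T.image (· + 1) := by
      simp only [Finset.mem_image, not_exists, not_and]
      intro x hx
      have := (mem_maximalFamily.1 hT).2.1 x hx
      omega
    intro T hT U hU h
    have h' := congrArg (Finset.erase · (n + (k + 1))) h
    simp only [Finset.erase_insert (hnot hT), Finset.erase_insert (hnot hU)] at h'
    exact Finset.image_injective (add_left_injective 1) h'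
  · intro S hS
    rw [Finset.mem_filter, mem_maximalFamily] at hS
    obtain ⟨T, hT, rfl⟩ := hS.1.exists_eq_insert_shift hk hS.2
    exact ⟨T, mem_maximalFamily.2 hT, rfl⟩

/-- Fix `k ≥ 2`. Then `J_{k,1} = 1`, `J_{k,n} = 0` for `2 ≤ n ≤ k+1`, `J_{k,n} = 1`
for `k+1 < n ≤ 2k+2`, and `J_{k,n} = J_{k,n-1} + J_{k,n-(k+1)}` for all `n > 2k+2`. -/
theorem schreierZeckendorfMaximal_recurrence (k : ℕ) (hk : 2 ≤ k) :
    schreierZeckendorfMaximal k 1 = 1 ∧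
    (∀ n : ℕ, 2 ≤ n → n ≤ k + 1 → schreierZeckendorfMaximal k n = 0) ∧
    (∀ n : ℕ, k + 1 < n → n ≤ 2 * k + 2 → schreierZeckendorfMaximal k n = 1) ∧
    (∀ n : ℕ, 2 * k + 2 < n →
      schreierZeckendorfMaximal k n =
        schreierZeckendorfMaximal k (n - 1) + schreierZeckendorfMaximal k (n - (k + 1))) := by
  classical
  simp only [schreierZeckendorfMaximal_eq_card]
  refine ⟨by simp [maximalFamily_one], fun n hn hn' => ?_, fun n hn hn' => ?_, fun n hn => ?_⟩
  · rw [maximalFamily_eq_empty hn hn', Finset.card_empty]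
  · rw [maximalFamily_eq_pair (by omega) hn hn', Finset.card_singleton]
  · obtain ⟨m, rfl⟩ : ∃ m, n = m + (k + 1) := ⟨n - (k + 1), by omega⟩
    have hmem := card_filter_mem_maximalFamily (k := k) (n := m) (by omega)
    have hnot := card_filter_notMem_maximalFamily (k := k) (n := m + k) (by omega) (by omega)
    rw [show m + k + 1 - k = m + 1 by omega, add_assoc] at hnot
    rw [← Finset.card_filter_add_card_filter_not (fun S => m + 1 ∈ S), hmem, hnot,
      Nat.add_sub_cancel, show m + (k + 1) - 1 = m + k by omega, add_comm]
end

section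
/- For every natural number n ≥ 1, the number of subsets S of {1, 2, ..., n} such that n ∈ S and every element of the difference set of S is odd equals F_{n+1}, the (n+1)-st Fibonacci number. (Singletons, having no difference set, are counted.) -/
/-- Any two consecutive elements of `S` differ by an odd number. -/
def OddGaps (S : Finset ℕ) : Prop :=
  ∀ a ∈ S, ∀ b ∈ S, a < b → (∀ c ∈ S, ¬(a < c ∧ c < b)) → Odd (b - a)

theorem oddGaps_insert_succ {n : ℕ} {S : Finset ℕ} (hS : ∀ x ∈ S, x ≤ n) (hn : n ∈ S) :
    OddGaps (insert (n + 1) S) ↔ OddGaps S := by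
  constructor
  · intro h a ha b hb hab hc
    refine h a (by simp [ha]) b (by simp [hb]) hab fun c hcS => ?_
    rcases Finset.mem_insert.1 hcS with rfl | hcS
    · have := hS b hb
      omega
    · exact hc c hcS
  · intro h a ha b hb hab hc
    rcases Finset.mem_insert.1 ha with rfl | ha
    · rcases Finset.mem_insert.1 hb with rfl | hb
      · omega
      · have := hS b hb
        omega
    · rcases Finset.mem_insert.1 hb with rfl | hb
      · have h₁ := hS a ha
        have h₂ := hc n (by simp [hn])
        obtain rfl : a = n := by omega
        simp
      · exact h a ha b hb hab fun c hcS => hc c (by simp [hcS])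

theorem OddGaps.insert_of_even_add {m n : ℕ} {T : Finset ℕ} (hm : ∀ x ∈ T, x < m)
    (hn : ∀ x ∈ T, x < n) (hmn : Even (m + n)) (h : OddGaps (insert m T)) :
    OddGaps (insert n T) := by
  intro a ha b hb hab hc
  rcases Finset.mem_insert.1 ha with rfl | haT
  · rcases Finset.mem_insert.1 hb with rfl | hb
    · omega
    · have := hn b hb
      omega
  · have ham := hm a haT
    rcases Finset.mem_insert.1 hb with rfl | hb
    · have hodd : Odd (m - a) := by
        refine h a (by simp [haT]) m (by simp) ham fun c hcS => ?_
        rcases Finset.mem_insert.1 hcS with rfl | hcS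
        · omega
        · have h₁ := hc c (by simp [hcS])
          have h₂ := hn c hcS
          omega
      rw [Nat.odd_iff] at hodd ⊢
      rw [Nat.even_iff] at hmn
      omega
    · refine h a (by simp [haT]) b (by simp [hb]) hab fun c hcS => ?_
      rcases Finset.mem_insert.1 hcS with rfl | hcS
      · have := hm b hb
        omega
      · exact hc c (by simp [hcS])

open Classical in
/-- The subsets of `{1, …, n}` containing `n` all of whose gaps are odd. -/
noncomputable def oddGapSets (n : ℕ) : Finset (Finset ℕ) :=
  (Finset.Icc 1 n).powerset.filter fun S => n ∈ S ∧ OddGaps S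

theorem mem_oddGapSets {n : ℕ} {S : Finset ℕ} :
    S ∈ oddGapSets n ↔ (∀ x ∈ S, 1 ≤ x ∧ x ≤ n) ∧ n ∈ S ∧ OddGaps S := by
  simp [oddGapSets, Finset.subset_iff]

theorem card_filter_mem_oddGapSets (n : ℕ) (hn : 1 ≤ n) :
    ((oddGapSets (n + 1)).filter fun S => n ∈ S).card = (oddGapSets n).card := by
  refine Finset.card_nbij' (fun S => S.erase (n + 1)) (fun S => insert (n + 1) S) ?_ ?_ ?_ ?_
  · intro S hS
    obtain ⟨hS, hnS⟩ := Finset.mem_filter.1 hS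
    obtain ⟨hle, hmem, hodd⟩ := mem_oddGapSets.1 hS
    have hlt : ∀ x ∈ S.erase (n + 1), 1 ≤ x ∧ x ≤ n := by
      intro x hx
      have h₁ := Finset.ne_of_mem_erase hx
      have h₂ := hle x (Finset.mem_of_mem_erase hx)
      omega
    have hn' : n ∈ S.erase (n + 1) := by simp [hnS]
    refine mem_oddGapSets.2 ⟨hlt, hn', ?_⟩
    rwa [← oddGaps_insert_succ (fun x hx => (hlt x hx).2) hn', Finset.insert_erase hmem]
  · intro S hS
    obtain ⟨hle, hmem, hodd⟩ := mem_oddGapSets.1 hS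
    refine Finset.mem_filter.2 ⟨mem_oddGapSets.2 ⟨?_, by simp, ?_⟩, by simp [hmem]⟩
    · intro x hx
      rcases Finset.mem_insert.1 hx with rfl | hx
      · omega
      · have := hle x hx
        omega
    · exact (oddGaps_insert_succ (fun x hx => (hle x hx).2) hmem).2 hodd
  · intro S hS
    exact Finset.insert_erase (mem_oddGapSets.1 (Finset.mem_filter.1 hS).1).2.1
  · intro S hS
    refine Finset.erase_insert fun h => ?_
    have := (mem_oddGapSets.1 hS).1 _ h
    omega

theorem card_filter_notMem_oddGapSets (n : ℕ) (hn : 1 ≤ n) :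
    ((oddGapSets (n + 2)).filter fun S => n + 1 ∉ S).card = (oddGapSets n).card := by
  have hlt {S : Finset ℕ} (hS : S ∈ (oddGapSets (n + 2)).filter fun S => n + 1 ∉ S) :
      ∀ x ∈ S.erase (n + 2), 1 ≤ x ∧ x < n := by
    obtain ⟨hS, hnS⟩ := Finset.mem_filter.1 hS
    obtain ⟨hle, hmem, hodd⟩ := mem_oddGapSets.1 hS
    intro x hx
    have h₁ := Finset.ne_of_mem_erase hx
    have hxS := Finset.mem_of_mem_erase hx
    have h₂ := hle x hxS
    have h₃ : x ≠ n + 1 := fun h => hnS (h ▸ hxS)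
    have h₄ : x ≠ n := by
      rintro rfl
      have hodd₂ := hodd x hxS (x + 2) hmem (by omega) fun c hc hcx => hnS (by
        rwa [show x + 1 = c by omega])
      rw [Nat.odd_iff] at hodd₂
      omega
    omega
  have hlt' {S : Finset ℕ} (hS : S ∈ oddGapSets n) : ∀ x ∈ S.erase n, 1 ≤ x ∧ x < n := by
    intro x hx
    have h₁ := Finset.ne_of_mem_erase hx
    have h₂ := (mem_oddGapSets.1 hS).1 x (Finset.mem_of_mem_erase hx)
    omega
  refine Finset.card_nbij' (fun S => insert n (S.erase (n + 2)))
    (fun S => insert (n + 2) (S.erase n)) ?_ ?_ ?_ ?_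
  · intro S hS
    have hlt := hlt hS
    obtain ⟨-, hmem, hodd⟩ := mem_oddGapSets.1 (Finset.mem_filter.1 hS).1
    refine mem_oddGapSets.2 ⟨?_, by simp, ?_⟩
    · intro x hx
      rcases Finset.mem_insert.1 hx with rfl | hx
      · omega
      · have := hlt x hx
        omega
    · rw [← Finset.insert_erase hmem] at hodd
      exact hodd.insert_of_even_add (fun x hx => by have := hlt x hx; omega)
        (fun x hx => (hlt x hx).2) ⟨n + 1, by ring⟩
  · intro S hS
    have hlt := hlt' hS
    obtain ⟨-, hmem, hodd⟩ := mem_oddGapSets.1 hS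
    refine Finset.mem_filter.2 ⟨mem_oddGapSets.2 ⟨?_, by simp, ?_⟩, fun h => ?_⟩
    · intro x hx
      rcases Finset.mem_insert.1 hx with rfl | hx
      · omega
      · have := hlt x hx
        omega
    · rw [← Finset.insert_erase hmem] at hodd
      exact hodd.insert_of_even_add (fun x hx => (hlt x hx).2)
        (fun x hx => by have := hlt x hx; omega) ⟨n + 1, by ring⟩
    · rcases Finset.mem_insert.1 h with h | h
      · omega
      · have := hlt _ h
        omega
  · intro S hS
    have hn : n ∉ S.erase (n + 2) := fun h => (hlt hS n h).2.false
    have hmem := (mem_oddGapSets.1 (Finset.mem_filter.1 hS).1).2.1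
    simp only [Finset.erase_insert hn, Finset.insert_erase hmem]
  · intro S hS
    have hn : n + 2 ∉ S.erase n := fun h => by have := hlt' hS _ h; omega
    simp only [Finset.erase_insert hn, Finset.insert_erase (mem_oddGapSets.1 hS).2.1]

theorem card_oddGapSets_add_two (n : ℕ) (hn : 1 ≤ n) :
    (oddGapSets (n + 2)).card = (oddGapSets n).card + (oddGapSets (n + 1)).card := by
  rw [← Finset.card_filter_add_card_filter_not (s := oddGapSets (n + 2)) (fun S => n + 1 ∈ S),
    card_filter_mem_oddGapSets (n + 1) (by omega), card_filter_notMem_oddGapSets n hn, add_comm]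

theorem oddGapSets_one : oddGapSets 1 = {{1}} := by
  ext S
  rw [mem_oddGapSets, Finset.mem_singleton]
  constructor
  · rintro ⟨hle, hmem, -⟩
    exact Finset.eq_singleton_iff_unique_mem.2 ⟨hmem, fun x hx => by have := hle x hx; omega⟩
  · rintro rfl
    simp [OddGaps]

theorem oddGapSets_two : oddGapSets 2 = {{2}, {1, 2}} := by
  ext S
  rw [mem_oddGapSets, Finset.mem_insert, Finset.mem_singleton]
  constructor
  · rintro ⟨hle, hmem, -⟩
    by_cases h : 1 ∈ S
    · right
      ext x
      have := hle x
      grind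
    · left
      ext x
      have := hle x
      grind
  · rintro (rfl | rfl) <;> simp [OddGaps]

theorem card_oddGapSets (n : ℕ) : (oddGapSets (n + 1)).card = Nat.fib (n + 2) := by
  induction n using Nat.twoStepInduction with
  | zero => simp [oddGapSets_one]
  | one =>
    rw [oddGapSets_two, Finset.card_pair (by decide)]
    rfl
  | more n ih₁ ih₂ =>
    rw [card_oddGapSets_add_two (n + 1) (by omega), ih₁, ih₂, ← Nat.fib_add_two]

open Classical in
/-- For every `n ≥ 1`, the number of subsets `S` of `{1, …, n}` with `n ∈ S` all
of whose consecutive-element differences (the elements of the difference set of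
`S`) are odd equals the `(n+1)`-st Fibonacci number.  The difference-set
condition is expressed as: for any `a < b` in `S` with no element of `S`
strictly between them, `b - a` is odd. -/
theorem card_odd_difference_sets_with_max (n : ℕ) (hn : 1 ≤ n) :
    ((Finset.Icc 1 n).powerset.filter
      (fun S => n ∈ S ∧ ∀ a ∈ S, ∀ b ∈ S, a < b →
        (∀ c ∈ S, ¬(a < c ∧ c < b)) → Odd (b - a))).card = Nat.fib (n + 1) := by
  obtain ⟨m, rfl⟩ := Nat.exists_eq_add_of_le' hn
  convert card_oddGapSets m
  ext S
  simp [oddGapSets, OddGaps]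
end

section
/- For every natural number n ≥ 1, the number of subsets S of {1, 2, ..., n} such that every element of the difference set of S is odd (the empty set and singletons vacuously qualify) equals F_{n+3} - 1, where F denotes the Fibonacci sequence. -/
theorem oddGaps_insert_iff {S : Finset ℕ} {x : ℕ} (hx : ∀ a ∈ S, a < x) :
    OddGaps (insert x S) ↔ OddGaps S ∧ ∀ a ∈ S, (∀ c ∈ S, c ≤ a) → Odd (x - a) := by
  constructor
  · intro h
    refine ⟨fun a ha b hb hab hc => ?_, fun a ha hc => ?_⟩
    · refine h a (by simp [ha]) b (by simp [hb]) hab fun c hcS => ?_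
      rcases Finset.mem_insert.1 hcS with rfl | hcS
      · have := hx b hb
        omega
      · exact hc c hcS
    · refine h a (by simp [ha]) x (by simp) (hx a ha) fun c hcS => ?_
      rcases Finset.mem_insert.1 hcS with rfl | hcS
      · omega
      · have := hc c hcS
        omega
  · rintro ⟨h, hmax⟩ a ha b hb hab hc
    rcases Finset.mem_insert.1 hb with rfl | hb
    · rcases Finset.mem_insert.1 ha with rfl | ha
      · omega
      · refine hmax a ha fun c hcS => ?_
        have := hc c (by simp [hcS])
        have := hx c hcS
        omega
    · rcases Finset.mem_insert.1 ha with rfl | ha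
      · exact absurd (hx b ‹_›) hab.not_gt
      · exact h a ha b ‹_› hab fun c hcS => hc c (by simp [hcS])

open Classical in
theorem Finset.card_filter_powerset_insert {α : Type*} [DecidableEq α] {a : α} {s : Finset α} (ha : a ∉ s)
    (p : Finset α → Prop) :
    ((insert a s).powerset.filter p).card =
      (s.powerset.filter p).card + (s.powerset.filter fun t => p (insert a t)).card := by
  simp only [Finset.card_filter]
  exact Finset.sum_powerset_insert ha _

theorem oddGaps_insert_succ_insert {S : Finset ℕ} {x : ℕ} (hx : ∀ a ∈ S, a < x) :
    OddGaps (insert (x + 1) (insert x S)) ↔ OddGaps (insert x S) := by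
  rw [oddGaps_insert_iff (x := x + 1)
    (by simpa using fun a ha => (hx a ha).trans (Nat.lt_succ_self x))]
  refine and_iff_left fun a ha hc => ?_
  have h₁ := hc x (by simp)
  have h₂ : a = x := by
    rcases Finset.mem_insert.1 ha with rfl | ha
    · rfl
    · have := hx a ha
      omega
  simp [h₂]

theorem oddGaps_insert_add_two {S : Finset ℕ} {x : ℕ} (hx : ∀ a ∈ S, a < x) :
    OddGaps (insert (x + 2) S) ↔ OddGaps (insert x S) := by
  rw [oddGaps_insert_iff hx, oddGaps_insert_iff fun a ha => (hx a ha).trans (by omega)]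
  refine and_congr_right fun _ => forall₂_congr fun a ha => imp_congr_right fun _ => ?_
  have := hx a ha
  simp only [Nat.odd_iff]
  omega

theorem not_oddGaps_insert_add_two_insert {S : Finset ℕ} {x : ℕ} (hx : ∀ a ∈ S, a < x) :
    ¬OddGaps (insert (x + 2) (insert x S)) := by
  intro h
  have := h x (by simp) (x + 2) (by simp) (by omega) fun c hc => by
    simp only [Finset.mem_insert] at hc
    rcases hc with rfl | rfl | hc
    · omega
    · omega
    · have := hx c hc
      omega
  simp [Nat.odd_iff] at this

theorem lt_succ_of_mem_powerset_Icc {n : ℕ} {S : Finset ℕ} (hS : S ∈ (Finset.Icc 1 n).powerset) :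
    ∀ a ∈ S, a < n + 1 := fun _ ha =>
  Nat.lt_succ_of_le (Finset.mem_Icc.1 (Finset.mem_powerset.1 hS ha)).2

open Classical in
theorem card_filter_powerset_Icc_succ (n : ℕ) (p : Finset ℕ → Prop) :
    ((Finset.Icc 1 (n + 1)).powerset.filter p).card =
      ((Finset.Icc 1 n).powerset.filter p).card +
        ((Finset.Icc 1 n).powerset.filter fun t => p (insert (n + 1) t)).card := by
  rw [← Finset.insert_Icc_right_eq_Icc_add_one (by omega : 1 ≤ n + 1),
    Finset.card_filter_powerset_insert (by simp)]

open Classical in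
theorem card_oddGaps_insert_succ (n : ℕ) :
    ((Finset.Icc 1 n).powerset.filter fun S => OddGaps (insert (n + 1) S)).card =
      Nat.fib (n + 2) := by
  induction n using Nat.twoStepInduction with
  | zero => simp [Finset.filter_singleton, OddGaps]
  | one =>
    rw [card_filter_powerset_Icc_succ]
    simp [Finset.filter_singleton, OddGaps, Nat.fib_add_two]
  | more n ih₀ ih₁ =>
    rw [card_filter_powerset_Icc_succ,
      Finset.filter_congr (fun S hS => oddGaps_insert_succ_insert (lt_succ_of_mem_powerset_Icc hS)),
      ih₁, card_filter_powerset_Icc_succ,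
      Finset.filter_congr (fun S hS => oddGaps_insert_add_two (lt_succ_of_mem_powerset_Icc hS)),
      ih₀, Finset.filter_false_of_mem
        (fun S hS => not_oddGaps_insert_add_two_insert (lt_succ_of_mem_powerset_Icc hS)),
      Finset.card_empty, add_zero, ← Nat.fib_add_two]

open Classical in
theorem card_oddGaps_add_one (n : ℕ) :
    ((Finset.Icc 1 n).powerset.filter OddGaps).card + 1 = Nat.fib (n + 3) := by
  induction n with
  | zero => simp [Finset.filter_singleton, OddGaps, Nat.fib_add_two]
  | succ n ih =>
    rw [card_filter_powerset_Icc_succ, card_oddGaps_insert_succ, Nat.fib_add_two (n := n + 2), ← ih]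
    omega

open Classical in
/-- For every `n ≥ 1`, the number of subsets `S` of `{1, …, n}` all of whose
consecutive-element differences (the elements of the difference set of `S`) are
odd (the empty set and singletons vacuously qualify) equals `F (n+3) - 1`. -/
theorem card_odd_difference_sets (n : ℕ) (hn : 1 ≤ n) :
    ((Finset.Icc 1 n).powerset.filter
      (fun S => ∀ a ∈ S, ∀ b ∈ S, a < b →
        (∀ c ∈ S, ¬(a < c ∧ c < b)) → Odd (b - a))).card = Nat.fib (n + 3) - 1 := by
  rw [← card_oddGaps_add_one, Nat.add_sub_cancel]
  congr 1
  ext S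
  simp only [Finset.mem_filter, OddGaps]
end

section
/- For every natural number n ≥ 1, the number of finite sets S of positive integers with max S = n and min S ≥ |S| (weak-Schreier sets with largest element n) equals F_n, the n-th Fibonacci number. -/
theorem weakSchreier_iff (S : Finset ℕ) (n : ℕ) :
    ((∀ x ∈ S, 0 < x) ∧ S.max = (n : WithBot ℕ) ∧ (S.card : WithTop ℕ) ≤ S.min) ↔
      n ∈ S ∧ ∀ x ∈ S, S.card ≤ x ∧ x ≤ n := by
  constructor
  · rintro ⟨-, hmax, hmin⟩
    refine ⟨Finset.mem_of_max hmax, fun x hx => ⟨?_, Finset.le_max_of_eq hx hmax⟩⟩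
    exact WithTop.coe_le_coe.1 (hmin.trans (Finset.min_le hx))
  · rintro ⟨hn, h⟩
    refine ⟨fun x hx => (Finset.card_pos.2 ⟨n, hn⟩).trans_le (h x hx).1, ?_, ?_⟩
    · exact le_antisymm (Finset.max_le fun x hx => WithBot.coe_le_coe.2 (h x hx).2)
        (Finset.le_max hn)
    · exact Finset.le_min fun x hx => WithTop.coe_le_coe.2 (h x hx).1

/-- The sets `T` for which `insert (m + 1) T` is weak-Schreier with largest element `m + 1`,
sorted by cardinality. -/
def weakSchreierTails (m : ℕ) : Finset (Finset ℕ) :=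
  (Finset.HasAntidiagonal.antidiagonal m).biUnion fun p =>
    Finset.powersetCard p.2 (Finset.Icc (p.2 + 1) m)

theorem mem_weakSchreierTails {m : ℕ} {T : Finset ℕ} :
    T ∈ weakSchreierTails m ↔ T.card ≤ m ∧ T ⊆ Finset.Icc (T.card + 1) m := by
  simp only [weakSchreierTails, Finset.mem_biUnion, Finset.HasAntidiagonal.mem_antidiagonal,
    Finset.mem_powersetCard, Prod.exists]
  constructor
  · rintro ⟨a, b, hab, hT, rfl⟩
    exact ⟨by lia, hT⟩
  · rintro ⟨hm, hT⟩
    exact ⟨m - T.card, T.card, by lia, hT, rfl⟩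

theorem card_weakSchreierTails (m : ℕ) : (weakSchreierTails m).card = Nat.fib (m + 1) := by
  rw [weakSchreierTails, Finset.card_biUnion, Nat.fib_succ_eq_sum_choose]
  · refine Finset.sum_congr rfl fun p hp => ?_
    rw [Finset.HasAntidiagonal.mem_antidiagonal] at hp
    rw [Finset.card_powersetCard, Nat.card_Icc, show m + 1 - (p.2 + 1) = p.1 by lia]
  · intro p hp q hq hpq
    refine Finset.disjoint_left.2 fun T hT hT' => ?_
    rw [Finset.mem_powersetCard] at hT hT'
    rw [Finset.mem_coe, Finset.HasAntidiagonal.mem_antidiagonal] at hp hq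
    exact hpq (Prod.ext (by lia) (by lia))

theorem notMem_of_mem_weakSchreierTails {m : ℕ} {T : Finset ℕ}
    (hT : T ∈ weakSchreierTails m) :
    m + 1 ∉ T := fun h => by
  have := Finset.mem_Icc.1 ((mem_weakSchreierTails.1 hT).2 h)
  lia

theorem mem_image_insert_weakSchreierTails {m : ℕ} {S : Finset ℕ} :
    S ∈ (weakSchreierTails m).image (insert (m + 1)) ↔
      m + 1 ∈ S ∧ ∀ x ∈ S, S.card ≤ x ∧ x ≤ m + 1 := by
  rw [Finset.mem_image]
  constructor
  · rintro ⟨T, hT, rfl⟩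
    rw [Finset.card_insert_of_notMem (notMem_of_mem_weakSchreierTails hT)]
    obtain ⟨hcard, hsub⟩ := mem_weakSchreierTails.1 hT
    refine ⟨Finset.mem_insert_self _ _, fun x hx => ?_⟩
    rcases Finset.mem_insert.1 hx with rfl | hx
    · lia
    · have := Finset.mem_Icc.1 (hsub hx)
      lia
  · rintro ⟨hS, h⟩
    have hcard := Finset.card_erase_add_one hS
    refine ⟨S.erase (m + 1), mem_weakSchreierTails.2 ⟨?_, fun x hx => ?_⟩,
      Finset.insert_erase hS⟩
    · have := (h _ hS).1
      lia
    · obtain ⟨hne, hx⟩ := Finset.mem_erase.1 hx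
      have := h x hx
      rw [Finset.mem_Icc]
      lia

/-- For every `n ≥ 1`, the number of finite sets `S` of positive integers with
`max S = n` and `min S ≥ |S|` (weak-Schreier sets with largest element `n`)
equals the `n`-th Fibonacci number. -/
theorem schreier_weak_max_card (n : ℕ) (hn : 1 ≤ n) :
    {S : Finset ℕ | (∀ x ∈ S, 0 < x) ∧ S.max = (n : WithBot ℕ) ∧
      (S.card : WithTop ℕ) ≤ S.min}.ncard = Nat.fib n := by
  obtain ⟨m, rfl⟩ := Nat.exists_eq_add_of_le' hn
  have hset : {S : Finset ℕ | (∀ x ∈ S, 0 < x) ∧ S.max = ((m + 1 : ℕ) : WithBot ℕ) ∧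
      (S.card : WithTop ℕ) ≤ S.min} =
        ((weakSchreierTails m).image (insert (m + 1)) : Finset (Finset ℕ)) := by
    ext S
    rw [Set.mem_ofPred_eq, weakSchreier_iff, Finset.mem_coe, mem_image_insert_weakSchreierTails]
  rw [hset, Set.ncard_coe_finset, Finset.card_image_of_injOn, card_weakSchreierTails]
  intro T hT U hU hTU
  rw [← Finset.erase_insert (notMem_of_mem_weakSchreierTails hT), hTU,
    Finset.erase_insert (notMem_of_mem_weakSchreierTails hU)]
end
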